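/- arXiv:1709.08280 — 10 statements merged into one kernel-verified Lean document; each statement's English description precedes it below -/
import Mathlib

section
/- Let (X, ρ) be a compact metric space and μ a finite Borel measure on X. Fix r > 0 and an integer k ≥ 1. Then among all r-cluster structures of order k there exists one of maximal measure; that is, there exists an r-cluster structure 𝒳* = {X₁*, …, X_k*} of order k such that for every r-cluster structure 𝒳 = {X₁, …, X_k} of order k one has Σ_{i=1}^k μ(X_i) ≤ Σ_{i=1}^k μ(X_i*). -/
open MeasureTheory

/-- An `r`-cluster structure of order `k`: a family of `k` Borel sets, each of
diameter at most `2r`, pairwise at distance at least `r`. -/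
def IsClusterStructure {X : Type*} [MetricSpace X] [MeasurableSpace X]
    (r : ℝ) (k : ℕ) (C : Fin k → Set X) : Prop :=
  (∀ i, MeasurableSet (C i)) ∧
  (∀ i, Metric.diam (C i) ≤ 2 * r) ∧
  (∀ i j : Fin k, i < j → ∀ x ∈ C i, ∀ y ∈ C j, r ≤ dist x y)

open Set

attribute [local instance] TopologicalSpace.vietoris

/-- The families of sets `C` with `C i ×ˢ C j` contained in a given closed relation form a closed
set. -/
theorem isClosed_setOf_forall_mem_mem {ι X : Type*} [TopologicalSpace X] {R : X → X → Prop}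
    (hR : IsClosed {p : X × X | R p.1 p.2}) (i j : ι) :
    IsClosed {C : ι → Set X | ∀ x ∈ C i, ∀ y ∈ C j, R x y} := by
  rw [← isOpen_compl_iff, isOpen_iff_mem_nhds]
  intro C hC
  simp only [mem_compl_iff, mem_ofPred_eq, not_forall] at hC
  obtain ⟨x, hx, y, hy, hxy⟩ := hC
  obtain ⟨V, W, hV, hW, hxV, hyW, hVW⟩ := isOpen_prod_iff.1 hR.isOpen_compl x y hxy
  have hmeet {U : Set X} (hU : IsOpen U) (l : ι) :
      IsOpen {D : ι → Set X | (D l ∩ U).Nonempty} :=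
    (TopologicalSpace.vietoris.isOpen_inter_nonempty_of_isOpen hU).preimage
      (continuous_apply (A := fun _ ↦ Set X) l)
  filter_upwards [(hmeet hV i).mem_nhds ⟨x, hx, hxV⟩, (hmeet hW j).mem_nhds ⟨y, hy, hyW⟩]
  rintro D ⟨x', hx', hx'V⟩ ⟨y', hy', hy'W⟩ hD
  exact hVW (mk_mem_prod hx'V hy'W) (hD x' hx' y' hy')

theorem isClosed_setOf_forall {X : Type*} [TopologicalSpace X] {ι : Sort*} {p : ι → X → Prop}
    (h : ∀ i, IsClosed {x | p i x}) : IsClosed {x | ∀ i, p i x} := by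
  rw [ofPred_forall]
  exact isClosed_iInter h

theorem upperSemicontinuous_measure_closure {X : Type*} [PseudoMetricSpace X] [MeasurableSpace X]
    [OpensMeasurableSpace X] (μ : Measure X) [IsFiniteMeasure μ] :
    UpperSemicontinuous fun F : Set X ↦ μ (closure F) := by
  intro F c hc
  have hlim := tendsto_measure_cthickening (μ := μ) (s := F) ⟨1, one_pos, measure_ne_top _ _⟩
  obtain ⟨δ, hδc, hδ⟩ :=
    (((hlim.mono_left nhdsWithin_le_nhds).eventually_lt_const hc).and
      (self_mem_nhdsWithin (s := Ioi (0 : ℝ)))).exists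
  filter_upwards [(Metric.isOpen_thickening (δ := δ) (E := F)).powerset_vietoris.mem_nhds
    (Metric.self_subset_thickening hδ F)] with G hG
  exact (measure_mono (closure_minimal
    (hG.trans (Metric.thickening_subset_cthickening δ F)) Metric.isClosed_cthickening)).trans_lt hδc

theorem diam_le_iff_forall_dist_le {X : Type*} [PseudoMetricSpace X] [CompactSpace X] {d : ℝ}
    (hd : 0 ≤ d) {F : Set X} :
    Metric.diam F ≤ d ↔ ∀ x ∈ F, ∀ y ∈ F, dist x y ≤ d :=
  ⟨fun h _ hx _ hy ↦
    (Metric.dist_le_diam_of_mem (isCompact_univ.isBounded.subset (subset_univ F)) hx hy).trans h,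
    Metric.diam_le_of_forall_dist_le hd⟩

theorem isCompact_setOf_diam_le_and_le_dist {X : Type*} [PseudoMetricSpace X] [CompactSpace X]
    {ι : Type*} [LT ι] {d : ℝ} (hd : 0 ≤ d) (r : ℝ) :
    IsCompact {C : ι → Set X | (∀ i, Metric.diam (C i) ≤ d) ∧
      ∀ i j, i < j → ∀ x ∈ C i, ∀ y ∈ C j, r ≤ dist x y} := by
  have hle : IsClosed {p : X × X | dist p.1 p.2 ≤ d} := isClosed_le continuous_dist continuous_const
  have hge : IsClosed {p : X × X | r ≤ dist p.1 p.2} := isClosed_le continuous_const continuous_dist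
  simp only [diam_le_iff_forall_dist_le hd]
  exact IsClosed.isCompact <|
    (isClosed_setOf_forall fun i ↦
      isClosed_setOf_forall_mem_mem (R := fun x y ↦ dist x y ≤ d) hle i i).and
    (isClosed_setOf_forall fun i ↦ isClosed_setOf_forall fun j ↦ isClosed_setOf_forall fun _ ↦
      isClosed_setOf_forall_mem_mem (R := fun x y ↦ r ≤ dist x y) hge i j)

theorem le_dist_of_mem_closure {X : Type*} [PseudoMetricSpace X] {r : ℝ} {F G : Set X}
    (h : ∀ x ∈ F, ∀ y ∈ G, r ≤ dist x y) : ∀ x ∈ closure F, ∀ y ∈ closure G, r ≤ dist x y := by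
  have hsub : closure (F ×ˢ G) ⊆ {p : X × X | r ≤ dist p.1 p.2} :=
    closure_minimal (fun p hp ↦ h p.1 hp.1 p.2 hp.2) (isClosed_le continuous_const continuous_dist)
  rw [closure_prod_eq] at hsub
  exact fun x hx y hy ↦ hsub (mk_mem_prod hx hy)

/-- Among all `r`-cluster structures of order `k` in a compact metric space with a
finite Borel measure, there is one of maximal measure. -/
theorem exists_max_cluster_structure
    {X : Type*} [MetricSpace X] [CompactSpace X]
    [MeasurableSpace X] [BorelSpace X]
    (μ : Measure X) [IsFiniteMeasure μ]
    (r : ℝ) (hr : 0 < r) (k : ℕ) (hk : 1 ≤ k) :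
    ∃ Cstar : Fin k → Set X, IsClusterStructure r k Cstar ∧
      ∀ C : Fin k → Set X, IsClusterStructure r k C →
        ∑ i, μ (C i) ≤ ∑ i, μ (Cstar i) := by
  have hd : 0 ≤ 2 * r := by positivity
  have husc : UpperSemicontinuous fun C : Fin k → Set X ↦ ∑ i, μ (closure (C i)) :=
    upperSemicontinuous_sum fun i _ ↦
      (upperSemicontinuous_measure_closure μ).comp (continuous_apply i)
  obtain ⟨C₀, ⟨hdiam, hdist⟩, hmax⟩ := (husc.upperSemicontinuousOn _).exists_isMaxOn
    ⟨fun _ ↦ ∅, by simp [hd]⟩ (isCompact_setOf_diam_le_and_le_dist (ι := Fin k) hd r)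
  refine ⟨fun i ↦ closure (C₀ i), ⟨fun i ↦ isClosed_closure.measurableSet, fun i ↦ ?_,
    fun i j hij ↦ le_dist_of_mem_closure (hdist i j hij)⟩, fun C hC ↦ ?_⟩
  · rw [Metric.diam_closure]
    exact hdiam i
  · exact (Finset.sum_le_sum fun i _ ↦ measure_mono subset_closure).trans (hmax hC.2)
end

section
/- For every δ > 0, every α > 0 and all real numbers 0 < r < r′, there exists a finite metric space (X, ρ) such that the number of ordered pairs (x, y) ∈ X² with ρ(x, y) > r′ is at most α·|X|², while every subset of X of diameter at most 2r has cardinality at most δ·|X|. -/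
open Finset in
/-- Hamming distance of two words, split along the first letter. -/
theorem hammingDist_cons {n : ℕ} {β : Type*} [DecidableEq β] (i j : β) (x y : Fin n → β) :
    hammingDist (Fin.cons i x : Fin (n + 1) → β) (Fin.cons j y) =
      (if i ≠ j then 1 else 0) + hammingDist x y := by
  simp only [hammingDist, card_filter, Fin.sum_univ_succ, Fin.cons_zero, Fin.cons_succ]

theorem hammingDist_add_hammingDist_not {n : ℕ} (x y : Fin n → Bool) :
    hammingDist x y + hammingDist x (fun i => !y i) = n := by
  have h : ∀ i, (x i ≠ !y i) ↔ ¬ (x i ≠ y i) := fun i => by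
    cases x i <;> cases y i <;> decide
  simp only [hammingDist, h]
  rw [Finset.card_filter_add_card_filter_not, Finset.card_univ, Fintype.card_fin]

open Finset in
/-- A set of binary words is counted by splitting it along the first letter. -/
theorem card_eq_card_cons_false_add_card_cons_true {n : ℕ} (A : Finset (Fin (n + 1) → Bool)) :
    #A = #{x : Fin n → Bool | (Fin.cons false x : Fin (n + 1) → Bool) ∈ A} +
      #{x : Fin n → Bool | (Fin.cons true x : Fin (n + 1) → Bool) ∈ A} := by
  have h : #A = ∑ x : Fin (n + 1) → Bool, if x ∈ A then 1 else 0 := by simp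
  rw [h, ← (Fin.consEquiv fun _ : Fin (n + 1) => Bool).sum_comp, Fintype.sum_prod_type,
    Fintype.sum_bool, card_filter, card_filter, add_comm]
  rfl

theorem add_le_mul_add_inv {u v M q : ℝ} (hM : 0 < M) (hq : 0 < q) (hu : u ≤ M * q)
    (hv : v ≤ M * q) (huv : u * v ≤ M ^ 2) : u + v ≤ M * (q + q⁻¹) := by
  have h : M * q * (u + v) ≤ M * q * (M * (q + q⁻¹)) := by
    have : M * q * (M * (q + q⁻¹)) = M ^ 2 * q ^ 2 + M ^ 2 := by field_simp
    nlinarith [mul_nonneg (sub_nonneg.2 hu) (sub_nonneg.2 hv)]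
  exact le_of_mul_le_mul_left h (by positivity)

open Finset Real in
/-- Two sets of binary words that are far apart in Hamming distance cannot both be large. -/
theorem card_mul_card_mul_exp_le {t : ℝ} (ht : 0 ≤ t) (n : ℕ) (s : ℝ)
    (A B : Finset (Fin n → Bool)) (h : ∀ a ∈ A, ∀ b ∈ B, s ≤ hammingDist a b) :
    (#A : ℝ) * #B * exp (t * s) ≤ (2 + 2 * cosh t) ^ n := by
  induction n generalizing s with
  | zero =>
    rcases A.eq_empty_or_nonempty with rfl | ⟨a, ha⟩
    · simp
    rcases B.eq_empty_or_nonempty with rfl | ⟨b, hb⟩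
    · simp
    have hs : s ≤ 0 := by simpa [Subsingleton.elim a b] using h a ha b hb
    have hA : (#A : ℝ) ≤ 1 := by exact_mod_cast card_le_one_of_subsingleton A
    have hB : (#B : ℝ) ≤ 1 := by exact_mod_cast card_le_one_of_subsingleton B
    have hE : exp (t * s) ≤ 1 := exp_le_one_iff.2 (mul_nonpos_of_nonneg_of_nonpos ht hs)
    rw [pow_zero]
    exact mul_le_one₀ (mul_le_one₀ hA (by positivity) hB) (by positivity) hE
  | succ n ih =>
    let slice (i : Bool) (C : Finset (Fin (n + 1) → Bool)) : Finset (Fin n → Bool) :=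
      {x | (Fin.cons i x : Fin (n + 1) → Bool) ∈ C}
    have same (i : Bool) : (#(slice i A) : ℝ) * #(slice i B) * exp (t * s) ≤
        (2 + 2 * cosh t) ^ n := by
      refine ih s _ _ fun a ha b hb => ?_
      simpa [hammingDist_cons] using h _ (mem_filter.1 ha).2 _ (mem_filter.1 hb).2
    have diff (i j : Bool) (hij : i ≠ j) :
        (#(slice i A) : ℝ) * #(slice j B) * exp (t * s) ≤ (2 + 2 * cosh t) ^ n * exp t := by
      have := ih (s - 1) (slice i A) (slice j B) fun a ha b hb => by
        have := h _ (mem_filter.1 ha).2 _ (mem_filter.1 hb).2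
        rw [hammingDist_cons, if_pos hij] at this
        push_cast at this
        linarith
      calc _ = (#(slice i A) : ℝ) * #(slice j B) * exp (t * (s - 1)) * exp t := by
            rw [mul_assoc _ (exp _), ← exp_add]; ring_nf
        _ ≤ _ := by gcongr
    have hM : 0 < (2 + 2 * cosh t) ^ n := by have := cosh_pos t; positivity
    have huv := mul_le_mul (same false) (same true) (by positivity) hM.le
    have key := add_le_mul_add_inv hM (exp_pos t) (diff false true (by decide))
      (diff true false (by decide)) (by linarith)
    have hcosh : exp t + (exp t)⁻¹ = 2 * cosh t := by rw [cosh_eq, exp_neg]; ring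
    rw [hcosh] at key
    rw [card_eq_card_cons_false_add_card_cons_true A,
      card_eq_card_cons_false_add_card_cons_true B]
    push_cast
    linarith [same false, same true, pow_succ (2 + 2 * cosh t) n]

open Finset Real in
/-- The exponential moment of the Hamming distance to a fixed binary word. -/
theorem sum_exp_mul_hammingDist {n : ℕ} (t : ℝ) (x : Fin n → Bool) :
    ∑ y : Fin n → Bool, exp (t * hammingDist x y) = (1 + exp t) ^ n := by
  have h (y : Fin n → Bool) :
      exp (t * hammingDist x y) = ∏ i, if x i ≠ y i then exp t else 1 := by
    rw [hammingDist, prod_ite, prod_const, prod_const_one, mul_one, mul_comm, exp_nat_mul]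
  simp_rw [h]
  rw [← Fintype.prod_sum fun i b => if x i ≠ b then exp t else 1]
  have hi (i : Fin n) : ∑ b, (if x i ≠ b then exp t else 1) = 1 + exp t := by
    cases x i <;> simp [add_comm]
  rw [prod_congr rfl fun i _ => hi i, prod_const, card_univ, Fintype.card_fin]

open Finset Real in
/-- Few pairs of binary words have Hamming distance well above half the length. -/
theorem card_hammingDist_gt_le (n : ℕ) {ε : ℝ} (hε : 0 ≤ ε) :
    (#{p : (Fin n → Bool) × (Fin n → Bool) | (1 + ε) / 2 * n < hammingDist p.1 p.2} : ℝ) ≤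
      exp (-(ε ^ 2 * n / 2)) * ((2 : ℝ) ^ n) ^ 2 := by
  set P : Finset ((Fin n → Bool) × (Fin n → Bool)) :=
    {p | (1 + ε) / 2 * n < hammingDist p.1 p.2}
  have hsum : (#P : ℝ) * exp (2 * ε * ((1 + ε) / 2 * n)) ≤ 2 ^ n * (1 + exp (2 * ε)) ^ n := by
    calc _ = ∑ p ∈ P, exp (2 * ε * ((1 + ε) / 2 * n)) := by
          rw [sum_const, nsmul_eq_mul]
      _ ≤ ∑ p ∈ P, exp (2 * ε * hammingDist p.1 p.2) := by
          refine sum_le_sum fun p hp => exp_le_exp.2 ?_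
          exact mul_le_mul_of_nonneg_left (mem_filter.1 hp).2.le (by positivity)
      _ ≤ ∑ p : (Fin n → Bool) × (Fin n → Bool), exp (2 * ε * hammingDist p.1 p.2) :=
          sum_le_univ_sum_of_nonneg fun _ => (exp_pos _).le
      _ = _ := by simp [Fintype.sum_prod_type, sum_exp_mul_hammingDist]
  have hcosh : 1 + exp (2 * ε) ≤ 2 * exp (ε + ε ^ 2 / 2) := by
    calc 1 + exp (2 * ε) = 2 * (exp ε * cosh ε) := by
          rw [cosh_eq, mul_div_assoc', mul_add, ← exp_add, ← exp_add]; ring_nf; simp [add_comm]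
      _ ≤ 2 * (exp ε * exp (ε ^ 2 / 2)) := by gcongr; exact cosh_le_exp_half_sq ε
      _ = _ := by rw [exp_add]
  have hpow : (1 + exp (2 * ε)) ^ n ≤ 2 ^ n * exp (n * (ε + ε ^ 2 / 2)) := by
    rw [exp_nat_mul, ← mul_pow]
    gcongr
  refine le_of_mul_le_mul_right (hsum.trans ?_) (exp_pos (2 * ε * ((1 + ε) / 2 * n)))
  calc _ ≤ (2 : ℝ) ^ n * (2 ^ n * exp (n * (ε + ε ^ 2 / 2))) := by gcongr
    _ = _ := by
      rw [mul_right_comm, ← exp_add]; ring_nf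

open Finset Real in
/-- Sets of binary words of Hamming diameter well below the length are small. -/
theorem card_le_of_hammingDist_le (n : ℕ) {ε : ℝ} (hε : 0 ≤ ε) (A : Finset (Fin n → Bool))
    (hA : ∀ a ∈ A, ∀ b ∈ A, (hammingDist a b : ℝ) ≤ (1 - ε) * n) :
    (#A : ℝ) ≤ exp (-(ε ^ 2 * n / 4)) * 2 ^ n := by
  let neg : (Fin n → Bool) → Fin n → Bool := fun x i => !x i
  have hneg : Function.Injective neg := fun x y hxy => by
    ext i; simpa [neg] using congrFun hxy i
  have h := card_mul_card_mul_exp_le hε n (ε * n) A (A.image neg) fun a ha b hb => by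
    obtain ⟨c, hc, rfl⟩ := mem_image.1 hb
    have h1 := hA a ha c hc
    have h2 : (hammingDist a c : ℝ) + hammingDist a (neg c) = n := by
      exact_mod_cast hammingDist_add_hammingDist_not a c
    linarith
  rw [card_image_of_injective _ hneg] at h
  have hcosh : 2 + 2 * cosh ε ≤ 4 * exp (ε ^ 2 / 2) := by
    linarith [cosh_le_exp_half_sq ε, one_le_exp (show 0 ≤ ε ^ 2 / 2 by positivity)]
  have hpow : (2 + 2 * cosh ε) ^ n ≤ 4 ^ n * exp (n * (ε ^ 2 / 2)) := by
    rw [exp_nat_mul, ← mul_pow]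
    have := cosh_pos ε
    gcongr
  refine le_of_sq_le_sq ?_ (by positivity)
  refine le_of_mul_le_mul_right ?_ (exp_pos (ε * (ε * n)))
  calc (#A : ℝ) ^ 2 * exp (ε * (ε * n)) = #A * #A * exp (ε * (ε * n)) := by ring
    _ ≤ 4 ^ n * exp (n * (ε ^ 2 / 2)) := h.trans hpow
    _ = _ := by
      rw [mul_pow, mul_right_comm, ← exp_nat_mul, ← exp_add, ← pow_mul, mul_comm n 2, pow_mul]
      push_cast
      ring_nf

/-- The Hamming metric rescaled by a positive factor. -/
@[reducible]
noncomputable def scaledHammingMetric {ι β : Type*} [Fintype ι] [DecidableEq β] (c : ℝ)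
    (hc : 0 < c) : MetricSpace (ι → β) where
  dist x y := c * hammingDist x y
  dist_self x := by simp
  dist_comm x y := by simp [hammingDist_comm]
  dist_triangle x y z := by
    rw [← mul_add]
    gcongr
    exact_mod_cast hammingDist_triangle x y z
  eq_of_dist_eq_zero {x y} h := by simpa [hc.ne'] using h

/-- For every `δ > 0`, `α > 0` and `0 < r < r'` there is a finite metric space in which
the number of ordered pairs at distance greater than `r'` is at most `α·|X|²`, yet every
subset of diameter at most `2r` has cardinality at most `δ·|X|`. -/
theorem exists_space_with_few_long_edges_and_small_clusters
    (δ α r r' : ℝ) (hδ : 0 < δ) (hα : 0 < α) (hr : 0 < r) (hrr' : r < r') :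
    ∃ (X : Type) (_ : MetricSpace X) (_ : Fintype X),
      Nonempty X ∧
      (Set.ncard {p : X × X | r' < dist p.1 p.2} : ℝ) ≤ α * (Fintype.card X : ℝ) ^ 2 ∧
      ∀ S : Set X, Metric.diam S ≤ 2 * r → (S.ncard : ℝ) ≤ δ * (Fintype.card X : ℝ) := by
  classical
  have hL : 0 < r' + r := by linarith
  obtain ⟨ε, hε, hεL⟩ : ∃ ε : ℝ, 0 < ε ∧ ε * (r' + r) = r' - r :=
    ⟨(r' - r) / (r' + r), div_pos (by linarith) hL, div_mul_cancel₀ _ hL.ne'⟩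
  have hlim : Filter.Tendsto (fun n : ℕ => Real.exp (-(ε ^ 2 / 4 * n))) Filter.atTop (nhds 0) :=
    Real.tendsto_exp_neg_atTop_nhds_zero.comp
      (tendsto_natCast_atTop_atTop.const_mul_atTop (by positivity))
  obtain ⟨n, ⟨hnδ, hnα⟩, hn⟩ := (((hlim.eventually_lt_const hδ).and
    (hlim.eventually_lt_const hα)).and (Filter.eventually_gt_atTop 0)).exists
  have hn : (0 : ℝ) < n := by exact_mod_cast hn
  let m : MetricSpace (Fin n → Bool) := scaledHammingMetric ((r' + r) / n) (by positivity)
  have hdist (x y : Fin n → Bool) : m.dist x y * n = (r' + r) * hammingDist x y := by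
    change (r' + r) / n * hammingDist x y * n = _
    field_simp
  have hcard : (Fintype.card (Fin n → Bool) : ℝ) = 2 ^ n := by simp
  refine ⟨Fin n → Bool, m, inferInstance, inferInstance, ?_, fun S hS => ?_⟩
  · rw [hcard, Set.ncard_eq_toFinset_card']
    refine le_trans ?_ ((card_hammingDist_gt_le n hε.le).trans ?_)
    · refine Nat.cast_le.2 (Finset.card_le_card fun p hp => ?_)
      have hp : r' < m.dist p.1 p.2 := by simpa using hp
      refine Finset.mem_filter.2 ⟨Finset.mem_univ _, lt_of_mul_lt_mul_left ?_ hL.le⟩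
      rw [← hdist]
      have := mul_lt_mul_of_pos_right hp hn
      linear_combination this + n * hεL / 2
    · gcongr
      refine le_trans (Real.exp_le_exp.2 ?_) hnα.le
      nlinarith [mul_pos (pow_pos hε 2) hn]
  · rw [hcard, Set.ncard_eq_toFinset_card']
    refine (card_le_of_hammingDist_le n hε.le _ fun a ha b hb => ?_).trans ?_
    · have hab : m.dist a b ≤ 2 * r :=
        (Metric.dist_le_diam_of_mem S.toFinite.isBounded (Set.mem_toFinset.1 ha)
          (Set.mem_toFinset.1 hb)).trans hS
      refine le_of_mul_le_mul_left ?_ hL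
      rw [← hdist]
      have := mul_le_mul_of_nonneg_right hab hn.le
      linear_combination this + n * hεL
    · gcongr
      refine le_trans (le_of_eq ?_) hnδ.le
      ring_nf
end

section
/- Fix integers n > k ≥ 2 and a real c > 0. Consider the minimization of f(w) = Σ_{j=1}^k w_j over vectors w = (w₁, …, w_n) ∈ ℝⁿ satisfying w₁ ≥ w₂ ≥ … ≥ w_n ≥ 0, Σ_{i=1}^n w_i = 1, and σ_{k+1}(w₁, …, w_n) ≤ c. If w is a minimizer of this problem, then either all coordinates of w are equal (w_i = w_j for all 1 ≤ i ≤ j ≤ n), or σ_{k+1}(w₁, …, w_n) = c. -/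
/-- The elementary symmetric polynomial `σ_s(w₁, …, w_n)`. -/
def esymmVal (n s : ℕ) (w : Fin n → ℝ) : ℝ :=
  ∑ A ∈ Finset.univ.powersetCard s, ∏ i ∈ A, w i

/-- Feasibility for the optimization problem: coordinates are nonincreasing,
nonnegative, sum to `1`, and `σ_{k+1}(w) ≤ c`. -/
def Feasible (n k : ℕ) (c : ℝ) (w : Fin n → ℝ) : Prop :=
  (∀ i j : Fin n, i ≤ j → w j ≤ w i) ∧ (∀ i, 0 ≤ w i) ∧
  (∑ i, w i) = 1 ∧ esymmVal n (k + 1) w ≤ c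

theorem continuous_esymmVal (n s : ℕ) : Continuous (esymmVal n s) := by
  unfold esymmVal
  fun_prop

/-- If the average of the first `k` entries of an antitone vector does not exceed the average of
all entries, then the vector is constant. -/
theorem Antitone.eq_of_card_mul_sum_castLE_le {n k : ℕ} (hk : 0 < k) (hkn : k < n)
    {w : Fin n → ℝ} (hw : Antitone w)
    (h : n * ∑ j : Fin k, w (Fin.castLE hkn.le j) ≤ k * ∑ i, w i) (i j : Fin n) :
    w i = w j := by
  obtain ⟨m, rfl⟩ : ∃ m, n = k + (m + 1) := Nat.exists_eq_add_of_lt hkn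
  have hcast (a : Fin k) : Fin.castLE hkn.le a = Fin.castAdd (m + 1) a := rfl
  have hle (p : Fin k × Fin (m + 1)) : w (Fin.natAdd k p.2) ≤ w (Fin.castAdd (m + 1) p.1) :=
    hw (by simp only [Fin.le_def, Fin.val_castAdd, Fin.val_natAdd]; omega)
  have hsum : ∑ p : Fin k × Fin (m + 1), w (Fin.natAdd k p.2) =
      ∑ p : Fin k × Fin (m + 1), w (Fin.castAdd (m + 1) p.1) := by
    refine le_antisymm (Finset.sum_le_sum fun p _ => hle p) ?_
    rw [Fin.sum_univ_add] at h
    simp only [hcast] at h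
    simp only [Fintype.sum_prod_type, Finset.sum_const, Finset.card_univ, Fintype.card_fin,
      nsmul_eq_mul, ← Finset.mul_sum]
    push_cast at h ⊢
    linarith
  have heq (a : Fin k) (b : Fin (m + 1)) : w (Fin.natAdd k b) = w (Fin.castAdd (m + 1) a) :=
    (Finset.sum_eq_sum_iff_of_le fun p _ => hle p).1 hsum (a, b) (Finset.mem_univ _)
  have hconst (i : Fin (k + (m + 1))) : w i = w (Fin.natAdd k 0) := by
    induction i using Fin.addCases with
    | left a => exact (heq a 0).symm
    | right b => rw [heq ⟨0, hk⟩ b, heq ⟨0, hk⟩ 0]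
  rw [hconst i, hconst j]

/-- Below the constraint level, a feasible vector can be moved slightly towards the constant
vector. -/
theorem Feasible.exists_feasible_add_mul {n k : ℕ} {c : ℝ} {w : Fin n → ℝ} (hn : 0 < n)
    (hw : Feasible n k c w) (hlt : esymmVal n (k + 1) w < c) :
    ∃ t : ℝ, 0 < t ∧ Feasible n k c fun i => (1 - t) * w i + t * (n : ℝ)⁻¹ := by
  have hcont : Continuous fun t : ℝ =>
      esymmVal n (k + 1) fun i => (1 - t) * w i + t * (n : ℝ)⁻¹ :=
    (continuous_esymmVal n (k + 1)).comp (by fun_prop)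
  have hsmall := (hcont.tendsto 0).eventually_lt_const (u := c) (by simpa using hlt)
  obtain ⟨t, ⟨ht, ht1⟩, ht0⟩ :=
    (((hsmall.and (eventually_lt_nhds one_pos)).filter_mono nhdsWithin_le_nhds).and
      (self_mem_nhdsWithin (s := Set.Ioi (0 : ℝ)))).exists
  obtain ⟨hanti, hnonneg, hsum, -⟩ := hw
  have h1t : 0 ≤ 1 - t := sub_nonneg.2 ht1.le
  have ht0' : 0 < t := ht0
  have hn' : (n : ℝ) ≠ 0 := by positivity
  refine ⟨t, ht0, fun i j hij => ?_, fun i => ?_, ?_, ht.le⟩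
  · have := hanti i j hij
    dsimp only
    gcongr
  · have := hnonneg i
    positivity
  · rw [Finset.sum_add_distrib, ← Finset.mul_sum, hsum]
    simp only [Finset.sum_const, Finset.card_univ, Fintype.card_fin, nsmul_eq_mul]
    field_simp
    ring

/-- If `w` minimizes `Σ_{j=1}^k w_j` over the feasible set, then either all coordinates
of `w` are equal, or `σ_{k+1}(w) = c`. -/
theorem minimizer_constant_or_tight
    (n k : ℕ) (hk : 2 ≤ k) (hkn : k < n) (c : ℝ) (hc : 0 < c)
    (w : Fin n → ℝ) (hw : Feasible n k c w)
    (hmin : ∀ v : Fin n → ℝ, Feasible n k c v →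
      ∑ j : Fin k, w (Fin.castLE hkn.le j) ≤ ∑ j : Fin k, v (Fin.castLE hkn.le j)) :
    (∀ i j : Fin n, i ≤ j → w i = w j) ∨ esymmVal n (k + 1) w = c := by
  refine or_iff_not_imp_right.2 fun hne i j _ => ?_
  have hn : 0 < n := by omega
  have hn' : (0 : ℝ) < n := Nat.cast_pos.2 hn
  obtain ⟨t, ht, hfeas⟩ :=
    hw.exists_feasible_add_mul hn (lt_of_le_of_ne hw.2.2.2 hne)
  have hle := hmin _ hfeas
  refine Antitone.eq_of_card_mul_sum_castLE_le (by omega) hkn (fun i j hij => hw.1 i j hij) ?_ i j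
  rw [Finset.sum_add_distrib, ← Finset.mul_sum, Finset.sum_const, Finset.card_univ,
    Fintype.card_fin, nsmul_eq_mul] at hle
  rw [hw.2.2.1, mul_one, mul_comm, ← le_div_iff₀ hn', div_eq_mul_inv]
  refine le_of_mul_le_mul_left ?_ ht
  linarith
end

section
/- Fix integers n > k ≥ 2 and a real c > 0 with (k+1)·c^{1/(k+1)} ≤ 1. Then every vector w = (w₁, …, w_n) ∈ ℝⁿ satisfying w₁ ≥ w₂ ≥ … ≥ w_n ≥ 0, Σ_{i=1}^n w_i = 1, and σ_{k+1}(w₁, …, w_n) ≤ c obeys Σ_{j=1}^k w_j ≥ 1 − (k+1)·c^{1/(k+1)}. -/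
theorem esymmVal_zero (n : ℕ) (w : Fin n → ℝ) : esymmVal n 0 w = 1 := by
  simp [esymmVal]

theorem esymmVal_nonneg {n : ℕ} (s : ℕ) {w : Fin n → ℝ} (hw : ∀ i, 0 ≤ w i) :
    0 ≤ esymmVal n s w :=
  Finset.sum_nonneg fun _ _ => Finset.prod_nonneg fun i _ => hw i

/-- Splitting off the first variable of an elementary symmetric polynomial. -/
theorem esymmVal_succ_succ (n s : ℕ) (w : Fin (n + 1) → ℝ) :
    esymmVal (n + 1) (s + 1) w =
      esymmVal n (s + 1) (fun i => w i.succ) + w 0 * esymmVal n s (fun i => w i.succ) := by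
  have h (m r : ℕ) (v : Fin m → ℝ) :
      esymmVal m r v = ((Finset.univ : Finset (Fin m)).val.map v).esymm r :=
    (Finset.esymm_map_val v Finset.univ r).symm
  have hu : (Finset.univ : Finset (Fin (n + 1))).val.map w =
      w 0 ::ₘ (Finset.univ : Finset (Fin n)).val.map (fun i => w i.succ) := by
    rw [Fin.univ_succ]
    simp [Function.comp_def]
  rw [h, h, h, hu]
  simp only [Multiset.esymm, Multiset.powersetCard_cons, Multiset.map_add, Multiset.sum_add,
    Multiset.map_map, Function.comp_def, Multiset.prod_cons, Multiset.sum_map_mul_left]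

/-- The sum of the entries of `w` whose zero-based index is at least `m`. -/
def tailSum (n m : ℕ) (w : Fin n → ℝ) : ℝ :=
  ∑ i : Fin n, if m ≤ i.val then w i else 0

theorem tailSum_nonneg {n : ℕ} (m : ℕ) {w : Fin n → ℝ} (hw : ∀ i, 0 ≤ w i) :
    0 ≤ tailSum n m w :=
  Finset.sum_nonneg fun i _ => by split_ifs <;> simp [hw i]

theorem tailSum_succ_zero (n : ℕ) (w : Fin (n + 1) → ℝ) :
    tailSum (n + 1) 0 w = w 0 + tailSum n 0 (fun i => w i.succ) := by
  simp [tailSum, Fin.sum_univ_succ]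

theorem tailSum_succ_succ (n m : ℕ) (w : Fin (n + 1) → ℝ) :
    tailSum (n + 1) (m + 1) w = tailSum n m (fun i => w i.succ) := by
  simp [tailSum, Fin.sum_univ_succ]

theorem tailSum_succ_le {n : ℕ} (m : ℕ) {w : Fin n → ℝ} (hw : ∀ i, 0 ≤ w i) :
    tailSum n (m + 1) w ≤ tailSum n m w := by
  refine Finset.sum_le_sum fun i _ => ?_
  have := hw i
  split_ifs <;> first | omega | linarith

theorem tailSum_le_add {n : ℕ} (m : ℕ) {w : Fin n → ℝ} {a : ℝ} (ha : 0 ≤ a)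
    (hw : ∀ i, w i ≤ a) : tailSum n m w ≤ tailSum n (m + 1) w + a := by
  have h : ∑ i : Fin n, (if i.val = m then w i else 0) ≤ a := by
    by_cases hm : m < n
    · have (i : Fin n) : i.val = m ↔ i = ⟨m, hm⟩ := by simp [Fin.ext_iff]
      simp [this, hw]
    · rw [Finset.sum_eq_zero fun i _ => if_neg (by omega)]
      exact ha
  have hs : tailSum n m w =
      tailSum n (m + 1) w + ∑ i : Fin n, (if i.val = m then w i else 0) := by
    unfold tailSum
    rw [← Finset.sum_add_distrib]
    refine Finset.sum_congr rfl fun i _ => ?_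
    split_ifs <;> first | omega | simp
  linarith

theorem pow_succ_le_pow_succ_add {x y : ℝ} (hy : 0 ≤ y) (hyx : y ≤ x) (m : ℕ) :
    x ^ (m + 1) ≤ y ^ (m + 1) + (m + 1) * (x - y) * x ^ m := by
  induction m with
  | zero => simp
  | succ m ih =>
    have h1 := mul_le_mul_of_nonneg_left ih (hy.trans hyx)
    have h2 : (x - y) * y ^ (m + 1) ≤ (x - y) * x ^ (m + 1) :=
      mul_le_mul_of_nonneg_left (pow_le_pow_left₀ hy hyx _) (sub_nonneg.2 hyx)
    push_cast
    linear_combination h1 + h2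

theorem tailSum_pow_le_factorial_mul_esymmVal {n : ℕ} (m : ℕ) {w : Fin n → ℝ}
    (hmono : Antitone w) (hw : ∀ i, 0 ≤ w i) :
    tailSum n m w ^ (m + 1) ≤ (m + 1).factorial * esymmVal n (m + 1) w := by
  induction n generalizing m with
  | zero =>
    have := esymmVal_nonneg (m + 1) hw
    simp only [tailSum, Finset.univ_eq_empty, Finset.sum_empty]
    rw [zero_pow (Nat.succ_ne_zero m)]
    positivity
  | succ n ih =>
    have hmono' : Antitone fun i : Fin n => w i.succ :=
      fun i j hij => hmono (Fin.succ_le_succ_iff.2 hij)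
    have hw' : ∀ i : Fin n, 0 ≤ w i.succ := fun i => hw _
    have ih' (m : ℕ) := ih m hmono' hw'
    rw [esymmVal_succ_succ]
    cases m with
    | zero =>
      have := ih' 0
      simp only [zero_add, pow_one, Nat.factorial_one, Nat.cast_one, one_mul] at this
      simp only [tailSum_succ_zero, esymmVal_zero, zero_add, pow_one, Nat.factorial_one,
        Nat.cast_one, one_mul, mul_one]
      linarith
    | succ m =>
      rw [tailSum_succ_succ]
      have hS := tailSum_nonneg m hw'
      have hp := pow_succ_le_pow_succ_add (tailSum_nonneg (m + 1) hw')
        (tailSum_succ_le m hw') (m + 1)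
      have hd := tailSum_le_add m (hw 0) fun i : Fin n => hmono (Fin.zero_le i.succ)
      have h1 := ih' (m + 1)
      have h2 := mul_le_mul_of_nonneg_left (ih' m)
        (mul_nonneg (by positivity : (0 : ℝ) ≤ (m : ℝ) + 1 + 1) (hw 0))
      have h3 := mul_le_mul_of_nonneg_right (sub_le_iff_le_add'.2 hd)
        (mul_nonneg (by positivity : (0 : ℝ) ≤ (m : ℝ) + 1 + 1) (pow_nonneg hS (m + 1)))
      rw [Nat.factorial_succ (m + 1)] at h1 ⊢
      push_cast at hp h1 ⊢
      linear_combination hp + h1 + h2 + h3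

theorem sum_castLE_add_tailSum {n k : ℕ} (hkn : k ≤ n) (w : Fin n → ℝ) :
    ∑ j : Fin k, w (Fin.castLE hkn j) + tailSum n k w = ∑ i, w i := by
  obtain ⟨d, rfl⟩ := Nat.exists_eq_add_of_le hkn
  have h (j : Fin k) : ¬ k ≤ j.val := by omega
  simp only [tailSum, Fin.sum_univ_add, Fin.val_castAdd, Fin.val_natAdd, h, if_false,
    Nat.le_add_right, if_true, Finset.sum_const_zero, zero_add]
  rfl

/-- If `(k+1)·c^{1/(k+1)} ≤ 1`, then every nonincreasing nonnegative vector `w` summing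
to `1` with `σ_{k+1}(w) ≤ c` satisfies `Σ_{j=1}^k w_j ≥ 1 − (k+1)·c^{1/(k+1)}`. -/
theorem opt_lower_bound
    (n k : ℕ) (hk : 2 ≤ k) (hkn : k < n) (c : ℝ) (hc : 0 < c)
    (hc1 : ((k : ℝ) + 1) * c ^ ((1 : ℝ) / ((k : ℝ) + 1)) ≤ 1)
    (w : Fin n → ℝ)
    (hmono : ∀ i j : Fin n, i ≤ j → w j ≤ w i)
    (hnonneg : ∀ i, 0 ≤ w i)
    (hsum : (∑ i, w i) = 1)
    (hesymm : esymmVal n (k + 1) w ≤ c) :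
    1 - ((k : ℝ) + 1) * c ^ ((1 : ℝ) / ((k : ℝ) + 1)) ≤
      ∑ j : Fin k, w (Fin.castLE hkn.le j) := by
  have hsplit := sum_castLE_add_tailSum hkn.le w
  have hfac : ((k + 1).factorial : ℝ) ≤ ((k : ℝ) + 1) ^ (k + 1) := by
    exact_mod_cast Nat.factorial_le_pow (k + 1)
  have hroot : (c ^ ((1 : ℝ) / ((k : ℝ) + 1))) ^ (k + 1) = c := by
    rw [one_div, ← Nat.cast_succ]
    exact Real.rpow_inv_natCast_pow hc.le (Nat.succ_ne_zero k)
  have htail : tailSum n k w ≤ ((k : ℝ) + 1) * c ^ ((1 : ℝ) / ((k : ℝ) + 1)) := by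
    refine le_of_pow_le_pow_left₀ (Nat.succ_ne_zero k) (by positivity) ?_
    calc tailSum n k w ^ (k + 1)
        ≤ (k + 1).factorial * esymmVal n (k + 1) w :=
          tailSum_pow_le_factorial_mul_esymmVal k (fun i j => hmono i j) hnonneg
      _ ≤ ((k : ℝ) + 1) ^ (k + 1) * c :=
          mul_le_mul hfac hesymm (esymmVal_nonneg _ hnonneg) (by positivity)
      _ = (((k : ℝ) + 1) * c ^ ((1 : ℝ) / ((k : ℝ) + 1))) ^ (k + 1) := by
          rw [mul_pow, hroot]
  linarith
end

section
/- Let (A, ρ) be a finite pseudometric space of diameter at most 3r, where r > 0, and let B ⊆ A be a subset of diameter at most 2r of maximum cardinality among all subsets of A of diameter at most 2r. Then the number of ordered pairs (x, y) ∈ A² with r < ρ(x, y) ≤ 3r is at least |A|·(|A| − |B|). -/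
/-- In a finite pseudometric space `A` of diameter at most `3r`, if `B` is a subset of
diameter at most `2r` of maximum cardinality, then the number of ordered pairs at
distance in `(r, 3r]` is at least `|A|·(|A| − |B|)`. -/
theorem medium_edges_lower_bound
    {A : Type*} [Fintype A] [PseudoMetricSpace A] (r : ℝ) (hr : 0 < r)
    (hdiam : Metric.diam (Set.univ : Set A) ≤ 3 * r)
    (B : Finset A) (hBdiam : Metric.diam (B : Set A) ≤ 2 * r)
    (hBmax : ∀ S : Finset A, Metric.diam (S : Set A) ≤ 2 * r → S.card ≤ B.card) :
    (Fintype.card A : ℝ) * ((Fintype.card A : ℝ) - (B.card : ℝ)) ≤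
      (Set.ncard {p : A × A | r < dist p.1 p.2 ∧ dist p.1 p.2 ≤ 3 * r} : ℝ) := by
  classical
  have hball (x : A) : ({y : A | dist x y ≤ r} : Finset A).card ≤ B.card := by
    refine hBmax _ (Metric.diam_le_of_forall_dist_le (by positivity) fun y hy z hz => ?_)
    simp only [Finset.coe_filter, Finset.mem_univ, true_and, Set.mem_ofPred_eq] at hy hz
    linarith [dist_triangle_left y z x]
  have hfar (x : A) : (Fintype.card A : ℝ) - B.card ≤ ({y : A | r < dist x y} : Finset A).card := by
    have h := Finset.card_filter_add_card_filter_not (s := (Finset.univ : Finset A))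
      (fun y => dist x y ≤ r)
    simp only [not_le, Finset.card_univ] at h
    rw [← h, sub_le_iff_le_add']
    exact_mod_cast Nat.add_le_add_right (hball x) _
  have hdist (x y : A) : dist x y ≤ 3 * r :=
    (Metric.dist_le_diam_of_mem Set.finite_univ.isBounded (Set.mem_univ x)
      (Set.mem_univ y)).trans hdiam
  have hcard : Set.ncard {p : A × A | r < dist p.1 p.2 ∧ dist p.1 p.2 ≤ 3 * r} =
      ∑ x : A, ({y : A | r < dist x y} : Finset A).card := by
    rw [← Finset.card_sigma, ← Set.ncard_coe_finset,
      ← Set.ncard_image_of_injective _ (Equiv.sigmaEquivProd A A).injective]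
    congr 1
    ext ⟨x, y⟩
    simp [hdist]
  rw [hcard, Nat.cast_sum, ← nsmul_eq_mul, ← Finset.card_univ]
  exact Finset.card_nsmul_le_sum _ _ _ fun x _ => hfar x
end

section
/- Let (Z, ρ) be a finite pseudometric space and r > 0. Let m be the maximum cardinality of a subset of Z of diameter at most 2r, and for s ≥ 1 let T_s(Z) denote the number of s-element subsets of Z whose points have pairwise distances exceeding r. Then for every s ≥ 3, T_s(Z) ≥ (1/s) · max(|Z| − (s − 1)·m, 0) · T_{s−1}(Z). -/
/-- The number of `s`-element subsets of a finite pseudometric space whose points have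
pairwise distances exceeding `r` (the number of `r`-anticliques of order `s`). -/
noncomputable def anticliqueCount (Z : Type*) [Fintype Z] [PseudoMetricSpace Z]
    (r : ℝ) (s : ℕ) : ℕ :=
  Set.ncard {S : Finset Z | S.card = s ∧
    ∀ x ∈ S, ∀ y ∈ S, x ≠ y → r < dist x y}

/-- A finite pseudometric space all of whose `2r`-clusters have at most `m` points contains at
least `|Z| - |S| * m` points at distance more than `r` from every point of `S`. -/
theorem card_sub_card_mul_le_card_far {Z : Type*} [Fintype Z] [PseudoMetricSpace Z] {r : ℝ}
    (hr : 0 ≤ r) {m : ℕ}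
    (hm : ∀ S : Finset Z, Metric.diam (S : Set Z) ≤ 2 * r → S.card ≤ m) (S : Finset Z) :
    Fintype.card Z - S.card * m ≤ (Finset.univ.filter fun z => ∀ x ∈ S, r < dist x z).card := by
  set far := Finset.univ.filter fun z => ∀ x ∈ S, r < dist x z
  have hfar : ∀ z, z ∈ far ↔ ∀ x ∈ S, r < dist x z := by simp [far]
  classical
  obtain ⟨near, hnear⟩ : ∃ near : Z → Finset Z, ∀ x z, z ∈ near x ↔ dist x z ≤ r :=
    ⟨fun x => Finset.univ.filter fun z => dist x z ≤ r, by simp⟩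
  have hcluster : ∀ x ∈ S, (near x).card ≤ m := by
    intro x _
    apply hm
    refine Metric.diam_le_of_forall_dist_le (by positivity) fun y hy z hz => ?_
    have hy := (hnear x y).1 (Finset.mem_coe.1 hy)
    have hz := (hnear x z).1 (Finset.mem_coe.1 hz)
    linarith [dist_triangle_left y z x]
  have hcover := Finset.card_biUnion_le_card_mul S near m hcluster
  have hunion : (Finset.univ : Finset Z) ⊆ far ∪ S.biUnion near := by
    intro z _
    by_cases hz : ∀ x ∈ S, r < dist x z
    · exact Finset.mem_union_left _ ((hfar z).2 hz)
    · push Not at hz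
      obtain ⟨x, hx, hxz⟩ := hz
      exact Finset.mem_union_right _ (Finset.mem_biUnion.2 ⟨x, hx, (hnear x z).2 hxz⟩)
  have hcard := (Finset.card_le_card hunion).trans (Finset.card_union_le _ _)
  rw [Finset.card_univ] at hcard
  exact Nat.sub_le_iff_le_add.2 (hcard.trans (Nat.add_le_add_left hcover _))

/-- Double counting of the pairs consisting of an anticlique of order `n + 1` and one of its
subsets of order `n`. -/
theorem anticliqueCount_mul_le_anticliqueCount_succ_mul {Z : Type*} [Fintype Z]
    [PseudoMetricSpace Z] {r : ℝ} (hr : 0 ≤ r) {m : ℕ}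
    (hm : ∀ S : Finset Z, Metric.diam (S : Set Z) ≤ 2 * r → S.card ≤ m) (n : ℕ) :
    anticliqueCount Z r n * (Fintype.card Z - n * m) ≤
      anticliqueCount Z r (n + 1) * (n + 1) := by
  classical
  have hcount : ∀ k, anticliqueCount Z r k = (Finset.univ.filter fun S : Finset Z =>
      S.card = k ∧ ∀ x ∈ S, ∀ y ∈ S, x ≠ y → r < dist x y).card := by
    intro k
    rw [anticliqueCount, ← Set.ncard_coe_finset]
    congr 1
    ext S
    simp
  rw [hcount, hcount]
  refine Finset.card_mul_le_card_mul (fun S T : Finset Z => S ⊆ T) (fun S hS => ?_)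
    fun T hT => ?_
  · obtain ⟨hcard, hS⟩ := (Finset.mem_filter.1 hS).2
    have hfar := card_sub_card_mul_le_card_far hr hm S
    rw [hcard] at hfar
    have hnotMem : ∀ z, (∀ x ∈ S, r < dist x z) → z ∉ S := by
      intro z hz hzS
      have := hz z hzS
      rw [dist_self] at this
      linarith
    refine hfar.trans (Finset.card_le_card_of_injOn (fun z => insert z S) ?_ ?_)
    · intro z hz
      have hz : ∀ x ∈ S, r < dist x z := by simpa using hz
      simp only [Finset.bipartiteAbove, Finset.coe_filter, Finset.mem_filter, Finset.mem_univ,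
        true_and, Set.mem_ofPred_eq]
      refine ⟨⟨by rw [Finset.card_insert_of_notMem (hnotMem z hz), hcard], ?_⟩,
        Finset.subset_insert z S⟩
      intro x hx y hy hxy
      rcases Finset.mem_insert.1 hx with rfl | hxS <;>
        rcases Finset.mem_insert.1 hy with rfl | hyS
      · exact absurd rfl hxy
      · rw [dist_comm]
        exact hz y hyS
      · exact hz x hxS
      · exact hS x hxS y hyS hxy
    · intro z hz w _ hzw
      have hz : ∀ x ∈ S, r < dist x z := by simpa using hz
      have hzw : insert z S = insert w S := hzw
      have hmem : z ∈ insert w S := hzw ▸ Finset.mem_insert_self z S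
      exact (Finset.mem_insert.1 hmem).resolve_right (hnotMem z hz)
  · have hcard := (Finset.mem_filter.1 hT).2.1
    calc _ ≤ (T.powersetCard n).card := by
          refine Finset.card_le_card fun S hS => ?_
          simp only [Finset.bipartiteBelow, Finset.mem_filter] at hS
          exact Finset.mem_powersetCard.2 ⟨hS.2, hS.1.2.1⟩
      _ = n + 1 := by
          rw [Finset.card_powersetCard, hcard, Nat.choose_succ_self_right]

/-- If `m` is the maximum cardinality of a subset of diameter at most `2r`, then for
every `s ≥ 3`, `T_s(Z) ≥ (1/s) · max(|Z| − (s−1)·m, 0) · T_{s−1}(Z)`. -/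
theorem anticlique_count_recurrence_internal
    {Z : Type*} [Fintype Z] [PseudoMetricSpace Z] (r : ℝ) (hr : 0 < r)
    (m : ℕ)
    (hm_exists : ∃ S : Finset Z, Metric.diam (S : Set Z) ≤ 2 * r ∧ S.card = m)
    (hm_max : ∀ S : Finset Z, Metric.diam (S : Set Z) ≤ 2 * r → S.card ≤ m)
    (s : ℕ) (hs : 3 ≤ s) :
    (1 / (s : ℝ)) * max ((Fintype.card Z : ℝ) - ((s : ℝ) - 1) * (m : ℝ)) 0 *
        (anticliqueCount Z r (s - 1) : ℝ) ≤
      (anticliqueCount Z r s : ℝ) := by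
  obtain ⟨n, rfl⟩ : ∃ n, s = n + 1 := ⟨s - 1, by omega⟩
  have hcount : (anticliqueCount Z r n : ℝ) * ((Fintype.card Z - n * m : ℕ) : ℝ) ≤
      (anticliqueCount Z r (n + 1) : ℝ) * ((n + 1 : ℕ) : ℝ) := by
    exact_mod_cast anticliqueCount_mul_le_anticliqueCount_succ_mul hr.le hm_max n
  have hmax : max ((Fintype.card Z : ℝ) - (((n + 1 : ℕ) : ℝ) - 1) * (m : ℝ)) 0 ≤
      ((Fintype.card Z - n * m : ℕ) : ℝ) := by
    refine max_le ?_ (Nat.cast_nonneg _)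
    have h : (Fintype.card Z : ℝ) ≤ ((Fintype.card Z - n * m : ℕ) : ℝ) + n * m := by
      exact_mod_cast le_tsub_add
    push_cast
    linarith
  rw [Nat.add_sub_cancel, mul_assoc, one_div, inv_mul_le_iff₀ (by positivity)]
  calc _ ≤ ((Fintype.card Z - n * m : ℕ) : ℝ) * (anticliqueCount Z r n : ℝ) := by gcongr
    _ ≤ _ := by linarith
end

section
/- Let (Z, ρ) be a finite pseudometric space, r > 0, and k ≥ 2 an integer. Let m be the maximum cardinality of a subset of Z of diameter at most 2r, and let T_{k+1}(Z) denote the number of (k+1)-element subsets of Z whose points have pairwise distances exceeding r. Then T_{k+1}(Z) ≥ (1/(k+1)!) · ∏_{j=1}^{k+1} max(|Z| − (j − 1)·m, 0). In particular, if (k+1)·m ≤ |Z|, then T_{k+1}(Z) ≥ (|Z|/(k+1))^{k+1}. -/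
open Classical in
/-- The finset of `r`-anticliques of order `s`. -/
noncomputable def anticliques (Z : Type*) [Fintype Z] [PseudoMetricSpace Z]
    (r : ℝ) (s : ℕ) : Finset (Finset Z) :=
  {S : Finset Z | S.card = s ∧ ∀ x ∈ S, ∀ y ∈ S, x ≠ y → r < dist x y}

theorem mem_anticliques {Z : Type*} [Fintype Z] [PseudoMetricSpace Z] {r : ℝ} {s : ℕ}
    {S : Finset Z} :
    S ∈ anticliques Z r s ↔ S.card = s ∧ ∀ x ∈ S, ∀ y ∈ S, x ≠ y → r < dist x y := by
  simp [anticliques]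

theorem anticliqueCount_eq_card (Z : Type*) [Fintype Z] [PseudoMetricSpace Z]
    (r : ℝ) (s : ℕ) : anticliqueCount Z r s = (anticliques Z r s).card := by
  rw [anticliqueCount, ← Set.ncard_coe_finset]
  congr 1
  ext S
  simp [mem_anticliques]

theorem anticliqueCount_zero (Z : Type*) [Fintype Z] [PseudoMetricSpace Z] (r : ℝ) :
    anticliqueCount Z r 0 = 1 := by
  rw [anticliqueCount_eq_card, Finset.card_eq_one]
  refine ⟨∅, ?_⟩
  ext S
  simp only [mem_anticliques, Finset.card_eq_zero, Finset.mem_singleton, and_iff_left_iff_imp]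
  rintro rfl
  simp

open Classical in
/-- If closed `r`-balls have at most `m` points, then all but `S.card * m` points are
farther than `r` from every point of `S`. -/
theorem le_card_filter_forall_lt_dist {Z : Type*} [Fintype Z] [PseudoMetricSpace Z]
    {r : ℝ} {m : ℕ} (hm : ∀ x : Z, (Finset.univ.filter fun y => dist x y ≤ r).card ≤ m)
    (S : Finset Z) :
    Fintype.card Z - S.card * m ≤ (Finset.univ.filter fun y => ∀ x ∈ S, r < dist x y).card := by
  have hcover : (Finset.univ : Finset Z) ⊆ (Finset.univ.filter fun y => ∀ x ∈ S, r < dist x y) ∪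
      S.biUnion fun x => Finset.univ.filter fun y => dist x y ≤ r := by
    intro y _
    by_cases hy : ∀ x ∈ S, r < dist x y
    · exact Finset.mem_union_left _ (by simpa using hy)
    · push Not at hy
      simpa using Or.inr hy
  have h₁ := (Finset.card_le_card hcover).trans (Finset.card_union_le _ _)
  have h₂ := Finset.card_biUnion_le_card_mul S _ m fun x _ => hm x
  rw [Finset.card_univ] at h₁
  omega

/-- Double counting of the pairs of nested anticliques of consecutive orders. -/
theorem anticliqueCount_mul_le {Z : Type*} [Fintype Z] [PseudoMetricSpace Z]
    {r : ℝ} (hr : 0 ≤ r) {m : ℕ}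
    (hm : ∀ S : Finset Z, Metric.diam (S : Set Z) ≤ 2 * r → S.card ≤ m) (s : ℕ) :
    anticliqueCount Z r s * (Fintype.card Z - s * m) ≤ anticliqueCount Z r (s + 1) * (s + 1) := by
  classical
  have hball : ∀ x : Z, (Finset.univ.filter fun y => dist x y ≤ r).card ≤ m := by
    intro x
    refine hm _ (Metric.diam_le_of_forall_dist_le (by positivity) fun y hy z hz => ?_)
    simp only [Finset.coe_filter, Finset.mem_univ, true_and, Set.mem_ofPred_eq] at hy hz
    linarith [dist_triangle_left y z x]
  rw [anticliqueCount_eq_card, anticliqueCount_eq_card]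
  refine Finset.card_mul_le_card_mul (fun S S' => S ⊆ S') (fun S hS => ?_) fun S' hS' => ?_
  · obtain ⟨rfl, hanti⟩ := mem_anticliques.1 hS
    refine (le_card_filter_forall_lt_dist hball S).trans ?_
    have hnot : ∀ y, (∀ x ∈ S, r < dist x y) → y ∉ S := fun y hy hyS => by
      have := hy y hyS
      rw [dist_self] at this
      linarith
    refine Finset.card_le_card_of_injOn (fun y => insert y S) (fun y hy => ?_)
      fun y hy z hz hyz => ?_
    · simp only [Finset.coe_filter, Finset.mem_univ, true_and, Set.mem_ofPred_eq] at hy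
      simp only [Finset.bipartiteAbove, Finset.coe_filter, Set.mem_ofPred_eq, mem_anticliques]
      refine ⟨⟨Finset.card_insert_of_notMem (hnot y hy), fun a ha b hb hab => ?_⟩,
        Finset.subset_insert _ _⟩
      rcases Finset.mem_insert.1 ha with rfl | haS <;>
        rcases Finset.mem_insert.1 hb with rfl | hbS
      · exact absurd rfl hab
      · exact dist_comm a b ▸ hy b hbS
      · exact hy a haS
      · exact hanti a haS b hbS hab
    · simp only [Finset.coe_filter, Finset.mem_univ, true_and, Set.mem_ofPred_eq] at hy
      exact (Finset.insert_inj (hnot y hy)).1 hyz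
  · have hcard := (mem_anticliques.1 hS').1
    calc _ ≤ (S'.powersetCard s).card := Finset.card_le_card fun S hS => by
          simp only [Finset.bipartiteBelow, Finset.mem_filter, mem_anticliques] at hS
          exact Finset.mem_powersetCard.2 ⟨hS.2, hS.1.1⟩
      _ = s + 1 := by rw [Finset.card_powersetCard, hcard, Nat.choose_succ_self_right]

theorem prod_le_factorial_mul_anticliqueCount {Z : Type*} [Fintype Z] [PseudoMetricSpace Z]
    {r : ℝ} (hr : 0 ≤ r) {m : ℕ}
    (hm : ∀ S : Finset Z, Metric.diam (S : Set Z) ≤ 2 * r → S.card ≤ m) (s : ℕ) :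
    ∏ j ∈ Finset.range s, (Fintype.card Z - j * m) ≤ s.factorial * anticliqueCount Z r s := by
  induction s with
  | zero => simp [anticliqueCount_zero]
  | succ s ih =>
    rw [Finset.prod_range_succ]
    calc _ ≤ s.factorial * anticliqueCount Z r s * (Fintype.card Z - s * m) := by gcongr
      _ ≤ s.factorial * (anticliqueCount Z r (s + 1) * (s + 1)) := by
        rw [mul_assoc]
        exact Nat.mul_le_mul_left _ (anticliqueCount_mul_le hr hm s)
      _ = _ := by rw [Nat.factorial_succ]; ring

/-- When `s * m ≤ n`, the product of the `n - j * m` over `j < s` dominates that of the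
`(s - j) * (n / s)`. -/
theorem factorial_mul_div_pow_le_prod {n m s : ℕ} (hs : s ≠ 0) (h : s * m ≤ n) :
    (s.factorial : ℝ) * ((n : ℝ) / s) ^ s ≤
      ∏ j ∈ Finset.range s, max ((n : ℝ) - j * m) 0 := by
  have hs' : (0 : ℝ) < s := by positivity
  have hmn : (m : ℝ) ≤ n / s := by
    rw [le_div_iff₀ hs', mul_comm]
    exact_mod_cast h
  have hfac : (s.factorial : ℝ) = ∏ j ∈ Finset.range s, ((s : ℝ) - j) := by
    rw [← Nat.descFactorial_self, Nat.descFactorial_eq_prod_range, Nat.cast_prod]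
    exact Finset.prod_congr rfl fun j hj => Nat.cast_sub (Finset.mem_range.1 hj).le
  have hpow : ((n : ℝ) / s) ^ s = ∏ _j ∈ Finset.range s, (n : ℝ) / s := by
    rw [Finset.prod_const, Finset.card_range]
  rw [hfac, hpow, ← Finset.prod_mul_distrib]
  refine Finset.prod_le_prod (fun j hj => ?_) fun j _ => le_max_of_le_left ?_
  · have : (j : ℝ) ≤ s := by exact_mod_cast (Finset.mem_range.1 hj).le
    exact mul_nonneg (sub_nonneg.2 this) (by positivity)
  · rw [sub_mul, mul_div_cancel₀ _ hs'.ne']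
    gcongr

/-- If `m` is the maximum cardinality of a subset of diameter at most `2r` and `k ≥ 2`,
then `T_{k+1}(Z) ≥ (1/(k+1)!) · ∏_{j=1}^{k+1} max(|Z| − (j−1)·m, 0)`; in particular, if
`(k+1)·m ≤ |Z|`, then `T_{k+1}(Z) ≥ (|Z|/(k+1))^{k+1}`. -/
theorem anticlique_count_product_bound
    {Z : Type*} [Fintype Z] [PseudoMetricSpace Z] (r : ℝ) (hr : 0 < r)
    (k : ℕ) (hk : 2 ≤ k) (m : ℕ)
    (hm_exists : ∃ S : Finset Z, Metric.diam (S : Set Z) ≤ 2 * r ∧ S.card = m)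
    (hm_max : ∀ S : Finset Z, Metric.diam (S : Set Z) ≤ 2 * r → S.card ≤ m) :
    (1 / (Nat.factorial (k + 1) : ℝ)) *
        ∏ j ∈ Finset.range (k + 1), max ((Fintype.card Z : ℝ) - (j : ℝ) * (m : ℝ)) 0 ≤
      (anticliqueCount Z r (k + 1) : ℝ) ∧
    ((k + 1) * m ≤ Fintype.card Z →
      ((Fintype.card Z : ℝ) / ((k : ℝ) + 1)) ^ (k + 1) ≤
        (anticliqueCount Z r (k + 1) : ℝ)) := by
  have hcast : ∀ j : ℕ, max ((Fintype.card Z : ℝ) - (j : ℝ) * (m : ℝ)) 0 =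
      ((Fintype.card Z - j * m : ℕ) : ℝ) := fun j => by
    rcases le_total (j * m) (Fintype.card Z) with h | h
    · rw [Nat.cast_sub h, Nat.cast_mul, max_eq_left]
      exact sub_nonneg.2 (by exact_mod_cast h)
    · rw [Nat.sub_eq_zero_of_le h, Nat.cast_zero, max_eq_right]
      exact sub_nonpos.2 (by exact_mod_cast h)
  have hprod : ∏ j ∈ Finset.range (k + 1), max ((Fintype.card Z : ℝ) - (j : ℝ) * (m : ℝ)) 0 ≤
      ((k + 1).factorial : ℝ) * anticliqueCount Z r (k + 1) := by
    simp_rw [hcast]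
    exact_mod_cast prod_le_factorial_mul_anticliqueCount hr.le hm_max (k + 1)
  have hfac : (0 : ℝ) < (k + 1).factorial := by positivity
  refine ⟨?_, fun h => ?_⟩
  · rw [one_div, inv_mul_le_iff₀ hfac]
    exact hprod
  · have := (factorial_mul_div_pow_le_prod k.succ_ne_zero h).trans hprod
    have := le_of_mul_le_mul_left this hfac
    exact_mod_cast this
end

section
/- Let (Z, ρ) be a finite pseudometric space and r > 0. Let X ⊆ Z be a subset of diameter at most 2r of maximum cardinality among all subsets of Z of diameter at most 2r, and assume ρ(x, z) ≤ 3r for all x ∈ X and z ∈ Z. Let P be an inclusion-maximal matching on Z \ X whose edges are (unordered) pairs of points at distance greater than 3r, let W be the set of points covered by P, and let Y = Z \ (X ∪ W). Then: (1) X ∪ Y has diameter at most 3r; (2) the number M(Z) of unordered pairs {x, y} of points of Z with r < ρ(x, y) ≤ 3r satisfies M(Z) ≥ (1/2)·(|X| + |Y|)·|Y| + (1/2)·|W|·|X|. -/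
/-- `P` is a matching on the complement of `X` all of whose edges are pairs of points at
distance greater than `3r`: its elements are two-element sets, disjoint from `X` and from
each other, whose two points are at distance greater than `3r`. -/
def IsLongMatching {Z : Type*} [Fintype Z] [PseudoMetricSpace Z]
    (r : ℝ) (X : Finset Z) (P : Finset (Finset Z)) : Prop :=
  (∀ e ∈ P, e.card = 2) ∧
  (∀ e ∈ P, ∀ x ∈ e, x ∉ X) ∧
  (∀ e ∈ P, ∀ x ∈ e, ∀ y ∈ e, x ≠ y → 3 * r < dist x y) ∧
  (∀ e ∈ P, ∀ f ∈ P, e ≠ f → Disjoint e f)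

/-- Twice the number of two-element sets with the symmetric relation `R` between their points
bounds the number of ordered `R`-related pairs of distinct points. -/
theorem card_related_pairs_le_two_mul_ncard {Z : Type*} [Fintype Z] [DecidableEq Z]
    (R : Z → Z → Prop) (hsymm : ∀ a b, R a b → R b a) (D : Finset (Z × Z))
    (hD : ∀ p ∈ D, p.1 ≠ p.2 ∧ R p.1 p.2) :
    D.card ≤ 2 * Set.ncard {e : Finset Z | e.card = 2 ∧
      ∀ x ∈ e, ∀ y ∈ e, x ≠ y → R x y} := by
  have hfib : ∀ e ∈ D.image (fun p : Z × Z => ({p.1, p.2} : Finset Z)),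
      (D.filter (fun p => ({p.1, p.2} : Finset Z) = e)).card ≤ 2 := by
    intro e he
    obtain ⟨⟨a, b⟩, -, rfl⟩ := Finset.mem_image.1 he
    refine (Finset.card_le_card (t := {(a, b), (b, a)}) ?_).trans Finset.card_le_two
    rintro ⟨c, d⟩ hcd
    obtain ⟨hcdD, hcd⟩ := Finset.mem_filter.1 hcd
    have hne : c ≠ d := (hD _ hcdD).1
    have hc : c ∈ ({a, b} : Finset Z) := hcd ▸ by simp
    have hd : d ∈ ({a, b} : Finset Z) := hcd ▸ by simp
    simp only [Finset.mem_insert, Finset.mem_singleton, Prod.mk.injEq] at *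
    grind
  refine (Finset.card_le_mul_card_image D 2 hfib).trans (Nat.mul_le_mul_left 2 ?_)
  rw [← Set.ncard_coe_finset]
  refine Set.ncard_le_ncard ?_ (Set.toFinite _)
  intro e he
  obtain ⟨⟨a, b⟩, hab, rfl⟩ := Finset.mem_image.1 (Finset.mem_coe.1 he)
  obtain ⟨hne, hR⟩ := hD _ hab
  refine ⟨Finset.card_pair hne, fun x hx y hy hxy => ?_⟩
  have hR' := hsymm _ _ hR
  simp only [Finset.mem_insert, Finset.mem_singleton] at hx hy
  rcases hx with rfl | rfl <;> rcases hy with rfl | rfl <;> first | exact absurd rfl hxy | assumption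

/-- Points avoiding `X` and an inclusion-maximal long matching are at distance at most `3r`. -/
theorem IsLongMatching.dist_le_of_maximal {Z : Type*} [Fintype Z] [PseudoMetricSpace Z]
    {r : ℝ} (hr : 0 ≤ r) {X : Finset Z} {P : Finset (Finset Z)} (hP : IsLongMatching r X P)
    (hPmax : ∀ P' : Finset (Finset Z), IsLongMatching r X P' → P ⊆ P' → P' = P)
    {y z : Z} (hyX : y ∉ X) (hzX : z ∉ X) (hyP : ∀ e ∈ P, y ∉ e) (hzP : ∀ e ∈ P, z ∉ e) :
    dist y z ≤ 3 * r := by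
  classical
  by_contra! hlong
  have hne : y ≠ z := by
    rintro rfl
    rw [dist_self] at hlong
    linarith
  obtain ⟨hcard, hdisjX, hdist, hdisj⟩ := hP
  have hpair : ∀ e ∈ P, Disjoint {y, z} e := fun e he => by
    simp [hyP e he, hzP e he]
  have hins : IsLongMatching r X (insert {y, z} P) := by
    refine ⟨fun e he => ?_, fun e he x hx => ?_, fun e he a ha b hb hab => ?_,
      fun e he f hf hef => ?_⟩
    · rcases Finset.mem_insert.1 he with rfl | he
      exacts [Finset.card_pair hne, hcard e he]
    · rcases Finset.mem_insert.1 he with rfl | he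
      · rcases Finset.mem_insert.1 hx with rfl | hx
        · exact hyX
        · rwa [Finset.mem_singleton.1 hx]
      · exact hdisjX e he x hx
    · rcases Finset.mem_insert.1 he with rfl | he
      · have hlong' : 3 * r < dist z y := by rwa [dist_comm]
        simp only [Finset.mem_insert, Finset.mem_singleton] at ha hb
        rcases ha with rfl | rfl <;> rcases hb with rfl | rfl <;>
          first | exact absurd rfl hab | assumption
      · exact hdist e he a ha b hb hab
    · rcases Finset.mem_insert.1 he with rfl | he <;> rcases Finset.mem_insert.1 hf with rfl | hf
      · exact absurd rfl hef
      · exact hpair f hf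
      · exact (hpair e he).symm
      · exact hdisj e he f hf hef
  have hmem : {y, z} ∈ P := hPmax _ hins (Finset.subset_insert _ _) ▸ Finset.mem_insert_self _ _
  exact hyP _ hmem (Finset.mem_insert_self _ _)

/-- A point within `3r` of every point is joined by a medium edge to at least one end of every
edge of a long matching. -/
theorem IsLongMatching.card_le_card_medium {Z : Type*} [Fintype Z] [PseudoMetricSpace Z]
    {r : ℝ} {X : Finset Z} {P : Finset (Finset Z)} (hr : 0 ≤ r) (hP : IsLongMatching r X P)
    {x : Z} (hx : ∀ z, dist x z ≤ 3 * r)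
    {N : Finset Z} (hN : ∀ e ∈ P, ∀ w ∈ e, r < dist x w → dist x w ≤ 3 * r → w ∈ N) :
    P.card ≤ N.card := by
  classical
  obtain ⟨hcard, -, hdist, hdisj⟩ := hP
  have hex : ∀ e ∈ P, ∃ w ∈ e, r < dist x w := by
    intro e he
    obtain ⟨a, b, hab, rfl⟩ := Finset.card_eq_two.1 (hcard e he)
    by_contra! hnear
    have ha := hnear a (by simp)
    have hb := hnear b (by simp)
    have := hdist _ he a (by simp) b (by simp) hab
    have := dist_triangle_left a b x
    linarith
  have : Nonempty Z := ⟨x⟩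
  choose! w hwe hwr using hex
  refine Finset.card_le_card_of_injOn w (fun e he => hN e he _ (hwe e he) (hwr e he) (hx _)) ?_
  intro e he f hf hef
  by_contra hne
  exact Finset.disjoint_left.1 (hdisj e he f hf hne) (hwe e he) (hef ▸ hwe f hf)

/-- Let `X` be a maximum-cardinality subset of diameter at most `2r` with
`ρ(x, z) ≤ 3r` for all `x ∈ X`, `z ∈ Z`, let `P` be an inclusion-maximal matching of
`r`-long edges on `Z \ X`, `W` the set of points covered by `P`, and
`Y = Z \ (X ∪ W)`.  Then `X ∪ Y` has diameter at most `3r`, and the number `M(Z)` of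
unordered pairs at distance in `(r, 3r]` satisfies
`M(Z) ≥ (1/2)·(|X| + |Y|)·|Y| + (1/2)·|W|·|X|`. -/
theorem medium_edges_matching_bound
    {Z : Type*} [Fintype Z] [PseudoMetricSpace Z] (r : ℝ) (hr : 0 < r)
    (X : Finset Z)
    (hXdiam : Metric.diam (X : Set Z) ≤ 2 * r)
    (hXmax : ∀ S : Finset Z, Metric.diam (S : Set Z) ≤ 2 * r → S.card ≤ X.card)
    (hX3r : ∀ x ∈ X, ∀ z : Z, dist x z ≤ 3 * r)
    (P : Finset (Finset Z)) (hP : IsLongMatching r X P)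
    (hPmax : ∀ P' : Finset (Finset Z), IsLongMatching r X P' → P ⊆ P' → P' = P)
    (W : Finset Z) (hW : ∀ x : Z, x ∈ W ↔ ∃ e ∈ P, x ∈ e)
    (Y : Finset Z) (hY : ∀ x : Z, x ∈ Y ↔ x ∉ X ∧ x ∉ W) :
    Metric.diam ((X : Set Z) ∪ (Y : Set Z)) ≤ 3 * r ∧
    ((X.card : ℝ) + (Y.card : ℝ)) * (Y.card : ℝ) / 2 +
        (W.card : ℝ) * (X.card : ℝ) / 2 ≤
      (Set.ncard {e : Finset Z | e.card = 2 ∧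
        ∀ x ∈ e, ∀ y ∈ e, x ≠ y → r < dist x y ∧ dist x y ≤ 3 * r} : ℝ) := by
  classical
  have hdistY : ∀ a ∈ X ∪ Y, ∀ b ∈ X ∪ Y, dist a b ≤ 3 * r := by
    intro a ha b hb
    rcases Finset.mem_union.1 ha with ha | ha
    · exact hX3r a ha b
    rcases Finset.mem_union.1 hb with hb | hb
    · exact dist_comm a b ▸ hX3r b hb a
    obtain ⟨haX, haW⟩ := (hY a).1 ha
    obtain ⟨hbX, hbW⟩ := (hY b).1 hb
    exact hP.dist_le_of_maximal hr.le hPmax haX hbX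
      (fun e he hae => haW ((hW a).2 ⟨e, he, hae⟩)) (fun e he hbe => hbW ((hW b).2 ⟨e, he, hbe⟩))
  refine ⟨Metric.diam_le_of_forall_dist_le (by positivity) fun a ha b hb =>
    hdistY a (by simpa using ha) b (by simpa using hb), ?_⟩
  have hXY : Disjoint X Y := Finset.disjoint_right.2 fun a ha => ((hY a).1 ha).1
  have hXW : Disjoint X W := Finset.disjoint_right.2 fun a ha => by
    obtain ⟨e, he, hae⟩ := (hW a).1 ha
    exact hP.2.1 e he a hae
  have hYW : Disjoint Y W := Finset.disjoint_left.2 fun a ha => ((hY a).1 ha).2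
  let R : Z → Z → Prop := fun a b => r < dist a b ∧ dist a b ≤ 3 * r
  have hsymm : ∀ a b, R a b → R b a := fun a b h => by simpa only [R, dist_comm b a] using h
  let A := ((X ∪ Y) ×ˢ (X ∪ Y)).filter fun p => R p.1 p.2
  let B := (X ×ˢ W).filter fun p => R p.1 p.2
  let C := (W ×ˢ X).filter fun p => R p.1 p.2
  have hA : (X.card + Y.card) * Y.card ≤ A.card := by
    have hdeg : ∀ a ∈ X ∪ Y, Y.card ≤ ((X ∪ Y).filter fun b => R a b).card := by
      intro a ha
      have hball : ((X ∪ Y).filter fun b => ¬ R a b).card ≤ X.card := by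
        refine hXmax _ (Metric.diam_le_of_forall_dist_le (by positivity) fun b hb c hc => ?_)
        have hnear : ∀ b ∈ (X ∪ Y).filter (fun b => ¬ R a b), dist a b ≤ r := by
          intro b hb
          obtain ⟨hb, hab⟩ := Finset.mem_filter.1 hb
          by_contra! hlt
          exact hab ⟨hlt, hdistY a ha b hb⟩
        have := hnear b hb
        have := hnear c hc
        have := dist_triangle_left b c a
        linarith
      have := Finset.card_filter_add_card_filter_not (s := X ∪ Y) (fun b => R a b)
      rw [Finset.card_union_of_disjoint hXY] at this
      omega
    rw [← Finset.card_union_of_disjoint hXY, Finset.card_filter, Finset.sum_product, ← smul_eq_mul]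
    refine Finset.card_nsmul_le_sum _ _ _ fun a ha => ?_
    rw [← Finset.card_filter]
    exact hdeg a ha
  have hB : X.card * P.card ≤ B.card := by
    rw [Finset.card_filter, Finset.sum_product, ← smul_eq_mul]
    refine Finset.card_nsmul_le_sum _ _ _ fun x hx => ?_
    rw [← Finset.card_filter]
    exact hP.card_le_card_medium hr.le (hX3r x hx) fun e he w hw h₁ h₂ =>
      Finset.mem_filter.2 ⟨(hW w).2 ⟨e, he, hw⟩, h₁, h₂⟩
  have hBC : B.card ≤ C.card := by
    refine Finset.card_le_card_of_injOn Prod.swap ?_ Prod.swap_injective.injOn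
    rintro ⟨a, b⟩ hab
    simp only [B, C, Finset.coe_filter, Finset.mem_product, Set.mem_ofPred_eq, Prod.swap] at hab ⊢
    exact ⟨hab.1.symm, hsymm _ _ hab.2⟩
  have hWP : W.card ≤ P.card * 2 := by
    have : W = P.biUnion id := by
      ext a
      simp [hW]
    rw [this]
    exact Finset.card_biUnion_le_card_mul _ _ _ fun e he => (hP.1 e he).le
  have hcard : (A ∪ (B ∪ C)).card = A.card + (B.card + C.card) := by
    have hXYW : Disjoint (X ∪ Y) W := Finset.disjoint_union_left.2 ⟨hXW, hYW⟩
    rw [Finset.card_union_of_disjoint, Finset.card_union_of_disjoint]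
    · exact Finset.disjoint_filter_filter (Finset.disjoint_product.2 (Or.inl hXW))
    · refine Finset.disjoint_union_right.2 ⟨?_, ?_⟩ <;> refine Finset.disjoint_filter_filter ?_
      · exact Finset.disjoint_product.2 (Or.inr hXYW)
      · exact Finset.disjoint_product.2 (Or.inl hXYW)
  have hD := card_related_pairs_le_two_mul_ncard R hsymm (A ∪ (B ∪ C)) fun p hp => by
    have hR : R p.1 p.2 := by
      simp only [A, B, C, Finset.mem_union, Finset.mem_filter] at hp
      tauto
    refine ⟨fun h => ?_, hR⟩
    have := hR.1
    rw [h, dist_self] at this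
    linarith
  have hWX : W.card * X.card ≤ 2 * (X.card * P.card) := by
    calc W.card * X.card ≤ P.card * 2 * X.card := Nat.mul_le_mul_right _ hWP
      _ = 2 * (X.card * P.card) := by ring
  have htotal : (X.card + Y.card) * Y.card + W.card * X.card ≤
      2 * Set.ncard {e : Finset Z | e.card = 2 ∧
        ∀ x ∈ e, ∀ y ∈ e, x ≠ y → r < dist x y ∧ dist x y ≤ 3 * r} := by
    refine le_trans ?_ hD
    omega
  have htotal' : ((X.card : ℝ) + Y.card) * Y.card + W.card * X.card ≤
      2 * (Set.ncard {e : Finset Z | e.card = 2 ∧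
        ∀ x ∈ e, ∀ y ∈ e, x ≠ y → r < dist x y ∧ dist x y ≤ 3 * r} : ℝ) := by
    exact_mod_cast htotal
  linarith
end

section
/- Let (X, ρ) be a finite pseudometric space with the counting measure, r > 0, k ≥ 2 an integer, and α, β > 0. Suppose that the number of ordered pairs (x, y) ∈ X² with r < ρ(x, y) ≤ 3r is at most α·|X|², and the number of ordered (k+1)-tuples (x₁, …, x_{k+1}) ∈ X^{k+1} with ρ(x_i, x_j) > r for all 1 ≤ i < j ≤ k+1 is at most β·|X|^{k+1}. Then there exists an r-cluster structure {X₁, …, X_k} of order k with Σ_{i=1}^k |X_i| ≥ (1 − √α·(2k + 1) − (k(e + 1) + 1)·β^{1/(k+1)})·|X|, where e is Euler's number. In particular, the r-cluster structure of order k of maximal measure 𝒳* satisfies |𝒳*| ≥ Ψ(α, β)·|X| with Ψ(α, β) = 1 − √α·(2k + 1) − (k(e + 1) + 1)·β^{1/(k+1)}. -/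
/-- An `r`-cluster structure of order `k` in a finite pseudometric space: a family of
`k` subsets, each of diameter at most `2r`, pairwise at distance at least `r`. -/
def IsFinClusterStructure {X : Type*} [Fintype X] [PseudoMetricSpace X]
    (r : ℝ) (k : ℕ) (C : Fin k → Finset X) : Prop :=
  (∀ i, Metric.diam ((C i : Set X)) ≤ 2 * r) ∧
  (∀ i j : Fin k, i < j → ∀ x ∈ C i, ∀ y ∈ C j, r ≤ dist x y)

open Finset in
open scoped Classical in
/-- If every closed `r`-ball around a point of `R` has at most `c` points, then `R` contains many
tuples with pairwise distances exceeding `r`. -/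
theorem pow_le_card_separated_tuples {X : Type*} [Fintype X] [PseudoMetricSpace X]
    (r c d : ℝ) (k : ℕ) (hd : 0 ≤ d) (hc : 0 ≤ c) (R : Finset X)
    (hball : ∀ x ∈ R, (#{y | dist x y ≤ r} : ℝ) ≤ c) (hR : d + k * c ≤ #R)
    (m : ℕ) (hm : m ≤ k + 1) :
    d ^ m ≤ #{f : Fin m → X | (∀ i, f i ∈ R) ∧ ∀ i j, i < j → r < dist (f i) (f j)} := by
  induction m with
  | zero => simp
  | succ m ih =>
    specialize ih (by lia)
    set S : Finset (Fin m → X) := {f | (∀ i, f i ∈ R) ∧ ∀ i j, i < j → r < dist (f i) (f j)}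
      with hS
    let E : (Fin m → X) → Finset X := fun f => {x ∈ R | ∀ i, r < dist (f i) x}
    have hE : ∀ f ∈ S, d ≤ #(E f) := by
      intro f hf
      have hfR : ∀ i, f i ∈ R := by simp only [hS, mem_filter] at hf; exact hf.2.1
      have hcover : R ⊆ E f ∪ univ.biUnion fun i => ({y | dist (f i) y ≤ r} : Finset X) := by
        intro x hx
        by_cases h : ∀ i, r < dist (f i) x
        · simp [E, hx, h]
        · push Not at h
          simp [h]
      have h1 : (#R : ℝ) ≤ #(E f) + ∑ i : Fin m, (#{y | dist (f i) y ≤ r} : ℝ) := by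
        have := (card_le_card hcover).trans ((card_union_le _ _).trans
          (Nat.add_le_add_left card_biUnion_le _))
        exact_mod_cast this
      have h2 : ∑ i : Fin m, (#{y | dist (f i) y ≤ r} : ℝ) ≤ m * c := by
        simpa using sum_le_card_nsmul univ _ c fun i _ => hball _ (hfR i)
      have h3 : (m : ℝ) * c ≤ k * c := by
        gcongr
        lia
      linarith
    have hcard : #(S.sigma E) ≤ #{f : Fin (m + 1) → X |
        (∀ i, f i ∈ R) ∧ ∀ i j, i < j → r < dist (f i) (f j)} := by
      refine card_le_card_of_injOn (fun p => Fin.snoc (α := fun _ => X) p.1 p.2) ?_ ?_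
      · rintro ⟨f, x⟩ h
        simp only [hS, E, coe_sigma, Set.mem_sigma_iff, mem_coe, mem_filter, mem_univ,
          true_and] at h
        obtain ⟨⟨hfR, hf⟩, hx, hfx⟩ := h
        simp only [coe_filter, mem_univ, true_and, Set.mem_ofPred_eq]
        refine ⟨Fin.lastCases (by simpa using hx) (by simpa using hfR), fun i j => ?_⟩
        induction j using Fin.lastCases with
        | last =>
          induction i using Fin.lastCases with
          | last => simp
          | cast i => simp [hfx]
        | cast j =>
          induction i using Fin.lastCases with
          | last => intro h; exact absurd h (Fin.castSucc_lt_last j).asymm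
          | cast i => simpa using hf i j
      · rintro ⟨f, x⟩ _ ⟨g, y⟩ _ h
        obtain ⟨rfl, rfl⟩ := Fin.snoc_injective2 h
        rfl
    calc d ^ (m + 1) ≤ #S * d := by rw [pow_succ]; gcongr
      _ ≤ ∑ f ∈ S, (#(E f) : ℝ) := by simpa using card_nsmul_le_sum S _ d hE
      _ = #(S.sigma E) := by rw [card_sigma]; push_cast; rfl
      _ ≤ _ := by exact_mod_cast hcard

/-- A tuple of points of `G` pairwise related by `P`, of length at most `k`, which either has
length `k` or cannot be extended. -/
theorem exists_tuple_length_eq_or_maximal {X : Type*} (G : X → Prop) (P : X → X → Prop) (k : ℕ) :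
    ∃ j ≤ k, ∃ x : Fin j → X, (∀ i, G (x i)) ∧ (∀ i i', i < i' → P (x i) (x i')) ∧
      (j = k ∨ ∀ y, G y → ∃ i, ¬ P (x i) y) := by
  induction k with
  | zero => exact ⟨0, le_rfl, Fin.elim0, fun i => i.elim0, fun i => i.elim0, .inl rfl⟩
  | succ k ih =>
    obtain ⟨j, hj, x, hG, hP, hmax⟩ := ih
    by_cases h : ∀ y, G y → ∃ i, ¬ P (x i) y
    · exact ⟨j, by lia, x, hG, hP, .inr h⟩
    obtain rfl := hmax.resolve_right h
    push Not at h
    obtain ⟨y, hy, hxy⟩ := h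
    refine ⟨j + 1, le_rfl, Fin.snoc (α := fun _ => X) x y,
      Fin.lastCases (by simpa using hy) (by simpa using hG), fun i i' => ?_, .inl rfl⟩
    induction i' using Fin.lastCases with
    | last =>
      induction i using Fin.lastCases with
      | last => simp
      | cast i => simp [hxy]
    | cast i' =>
      induction i using Fin.lastCases with
      | last => intro h; exact absurd h (Fin.castSucc_lt_last i').asymm
      | cast i => simpa using hP i i'

open Finset in
/-- Markov's inequality for the degrees of a relation with at most `t ^ 2` pairs. -/
theorem card_large_degree_le {X : Type*} [Fintype X] (P : X → X → Prop)
    [∀ x, DecidablePred (P x)] (t : ℝ) [DecidablePred fun x => t < #{y | P x y}] (ht : 0 < t)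
    (hP : (Set.ncard {p : X × X | P p.1 p.2} : ℝ) ≤ t ^ 2) :
    (#{x | t < #{y | P x y}} : ℝ) ≤ t := by
  have hsum : (Set.ncard {p : X × X | P p.1 p.2} : ℝ) = ∑ x, (#{y | P x y} : ℝ) := by
    classical
    rw [← Nat.cast_sum, ← card_sigma, Set.ncard_eq_toFinset_card']
    congr 1
    exact card_bij' (fun p _ => ⟨p.1, p.2⟩) (fun p _ => (p.1, p.2)) (by simp) (by simp)
      (by simp) (by simp)
  have h : (#{x | t < #{y | P x y}} : ℝ) * t ≤ t * t := by
    rw [← sq t]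
    refine le_trans ?_ (hsum ▸ hP)
    calc (#{x | t < #{y | P x y}} : ℝ) * t
        ≤ ∑ x with t < #{y | P x y}, (#{y | P x y} : ℝ) := by
          simpa using card_nsmul_le_sum _ (fun x => (#{y | P x y} : ℝ)) t fun x hx =>
            (mem_filter.1 hx).2.le
      _ ≤ _ := sum_le_sum_of_subset_of_nonneg (filter_subset _ _) fun _ _ _ => by positivity
  exact le_of_mul_le_mul_right h ht

open Finset in
open scoped Classical in
/-- If there are few tuples with pairwise distances exceeding `r`, then few points are far from
all of `k` centers with large, well separated balls. -/
theorem card_le_of_large_balls {X : Type*} [Fintype X] [PseudoMetricSpace X] (r c : ℝ)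
    (hr : 0 < r) (hc : 0 < c) (k : ℕ)
    (hanti : (Set.ncard {f : Fin (k + 1) → X |
      ∀ i j : Fin (k + 1), i < j → r < dist (f i) (f j)} : ℝ) ≤ c ^ (k + 1))
    (x : Fin k → X) (hx : ∀ i, c ≤ #{y | dist (x i) y ≤ r})
    (hsep : ∀ i j, i < j → 3 * r < dist (x i) (x j))
    (R : Finset X) (hR : ∀ y ∈ R, ∀ i, 3 * r < dist (x i) y) : (#R : ℝ) ≤ c := by
  let B : Fin k → Finset X := fun i => {y | dist (x i) y ≤ r}
  have hsub : (Fintype.piFinset (Fin.snoc (α := fun _ => Finset X) B R) : Set (Fin (k + 1) → X)) ⊆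
      {f | ∀ i j : Fin (k + 1), i < j → r < dist (f i) (f j)} := by
    intro f hf i j
    have hf' : ∀ i, f i ∈ Fin.snoc (α := fun _ => Finset X) B R i := by simpa using hf
    have hfB : ∀ i : Fin k, dist (x i) (f i.castSucc) ≤ r := fun i => by
      simpa [B] using hf' i.castSucc
    have hfR : f (Fin.last k) ∈ R := by simpa using hf' (Fin.last k)
    induction j using Fin.lastCases with
    | last =>
      induction i using Fin.lastCases with
      | last => simp
      | cast i =>
        intro _
        linarith [dist_triangle (x i) (f i.castSucc) (f (Fin.last k)), hfB i, hR _ hfR i]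
    | cast j =>
      induction i using Fin.lastCases with
      | last => intro h; exact absurd h (Fin.castSucc_lt_last j).asymm
      | cast i =>
        intro h
        linarith [dist_triangle4_right (x i) (x j) (f i.castSucc) (f j.castSucc), hfB i, hfB j,
          hsep i j (by simpa using h)]
  have hcard := Set.ncard_le_ncard hsub
  rw [Set.ncard_coe_finset, Fintype.card_piFinset, Fin.prod_univ_castSucc] at hcard
  simp only [Fin.snoc_castSucc, Fin.snoc_last] at hcard
  have hprod : c ^ k ≤ ∏ i, (#(B i) : ℝ) := by
    simpa using prod_le_prod (s := univ) (f := fun _ : Fin k => c) (fun _ _ => hc.le)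
      fun i _ => hx i
  have h : c ^ k * #R ≤ c ^ k * c := by
    rw [← pow_succ]
    calc c ^ k * (#R : ℝ) ≤ (∏ i, (#(B i) : ℝ)) * #R := by gcongr
      _ ≤ _ := le_trans (by exact_mod_cast hcard) hanti
  exact le_of_mul_le_mul_left h (by positivity)

open Finset in
open scoped Classical in
/-- Cluster structures from thresholds `t` on the medium degree and `c` on the ball sizes. -/
theorem exists_isFinClusterStructure_card_ge {X : Type*} [Fintype X] [PseudoMetricSpace X]
    (r t c : ℝ) (hr : 0 < r) (ht : 0 < t) (hc : 0 < c) (k : ℕ)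
    (hmed : (Set.ncard {p : X × X | r < dist p.1 p.2 ∧ dist p.1 p.2 ≤ 3 * r} : ℝ) ≤ t ^ 2)
    (hanti : (Set.ncard {f : Fin (k + 1) → X |
        ∀ i j : Fin (k + 1), i < j → r < dist (f i) (f j)} : ℝ) ≤ c ^ (k + 1)) :
    ∃ C : Fin k → Finset X, IsFinClusterStructure r k C ∧
      (Fintype.card X : ℝ) - (k + 1) * t - (k + 1) * c ≤ ∑ i, ((C i).card : ℝ) := by
  let M : X → Finset X := fun x => {y | r < dist x y ∧ dist x y ≤ 3 * r}
  let B : X → Finset X := fun x => {y | dist x y ≤ r}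
  let A : Finset X := {x | t < #(M x)}
  have hA : (#A : ℝ) ≤ t :=
    card_large_degree_le (fun x y => r < dist x y ∧ dist x y ≤ 3 * r) t ht hmed
  obtain ⟨j, hj, x, hG, hsep, hmax⟩ := exists_tuple_length_eq_or_maximal
    (fun x => x ∉ A ∧ c ≤ #(B x)) (fun x y => 3 * r < dist x y) k
  let R : Finset X := {y | y ∉ A ∧ ∀ i, 3 * r < dist (x i) y}
  have hR : (#R : ℝ) ≤ (k + 1) * c := by
    rcases hmax with rfl | hmax
    · have := card_le_of_large_balls r c hr hc j hanti x (fun i => (hG i).2) hsep R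
        fun y hy => (mem_filter.1 hy).2.2
      have : 0 ≤ (j : ℝ) * c := by positivity
      linarith
    · by_contra! hlt
      have hball : ∀ y ∈ R, (#(B y) : ℝ) ≤ c := by
        intro y hy
        by_contra! h
        simp only [R, mem_filter, mem_univ, true_and] at hy
        obtain ⟨i, hi⟩ := hmax y ⟨hy.1, h.le⟩
        exact hi (hy.2 i)
      have hd : c < #R - k * c := by linarith
      have h := pow_le_card_separated_tuples r c (#R - k * c) k (hc.le.trans hd.le) hc.le R hball
        (by linarith) (k + 1) le_rfl
      have hsub : #{f : Fin (k + 1) → X | (∀ i, f i ∈ R) ∧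
          ∀ i j, i < j → r < dist (f i) (f j)} ≤ Set.ncard {f : Fin (k + 1) → X |
            ∀ i j : Fin (k + 1), i < j → r < dist (f i) (f j)} := by
        rw [← Set.ncard_coe_finset]
        exact Set.ncard_le_ncard fun f hf => by simp at hf; exact hf.2
      have hsub' : (#{f : Fin (k + 1) → X | (∀ i, f i ∈ R) ∧
          ∀ i j, i < j → r < dist (f i) (f j)} : ℝ) ≤ c ^ (k + 1) :=
        le_trans (by exact_mod_cast hsub) hanti
      have := pow_lt_pow_left₀ hd hc.le (Nat.add_one_ne_zero k)
      linarith
  let C : Fin k → Finset X := fun i => if h : (i : ℕ) < j then B (x ⟨i, h⟩) else ∅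
  have hC : ∀ i, ∀ y ∈ C i, ∃ h : (i : ℕ) < j, dist (x ⟨i, h⟩) y ≤ r := by
    intro i y hy
    by_cases h : (i : ℕ) < j
    · exact ⟨h, by simpa [C, h, B] using hy⟩
    · simp [C, h] at hy
  refine ⟨C, ⟨fun i => ?_, fun i i' hii' y hy z hz => ?_⟩, ?_⟩
  · refine Metric.diam_le_of_forall_dist_le (by positivity) fun y hy z hz => ?_
    obtain ⟨_, hy⟩ := hC i y hy
    obtain ⟨_, hz⟩ := hC i z hz
    linarith [dist_triangle_left y z (x ⟨i, by assumption⟩)]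
  · obtain ⟨hi, hy⟩ := hC i y hy
    obtain ⟨hi', hz⟩ := hC i' z hz
    have := hsep ⟨i, hi⟩ ⟨i', hi'⟩ hii'
    linarith [dist_triangle4_right (x ⟨i, hi⟩) (x ⟨i', hi'⟩) y z]
  · have hcover : (univ : Finset X) ⊆
        univ.biUnion C ∪ (A ∪ (univ.biUnion (fun i => M (x i)) ∪ R)) := by
      intro y _
      simp only [mem_union, mem_biUnion, mem_univ, true_and]
      by_cases hyA : y ∈ A
      · exact .inr (.inl hyA)
      by_cases hyR : ∀ i, 3 * r < dist (x i) y
      · exact .inr (.inr (.inr (by simp [R, hyA, hyR])))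
      push Not at hyR
      obtain ⟨i, hi⟩ := hyR
      by_cases hir : dist (x i) y ≤ r
      · exact .inl ⟨⟨i, by lia⟩, by simp [C, B, hir]⟩
      · exact .inr (.inr (.inl ⟨i, by simpa [M, hi] using hir⟩))
    have hcard : Fintype.card X ≤ ∑ i, #(C i) + (#A + (∑ i, #(M (x i)) + #R)) := by
      refine (card_le_card hcover).trans ?_
      grw [card_union_le, card_union_le, card_union_le, card_biUnion_le, card_biUnion_le]
    have hcard' : (Fintype.card X : ℝ) ≤
        ∑ i, (#(C i) : ℝ) + (#A + (∑ i, (#(M (x i)) : ℝ) + #R)) := by exact_mod_cast hcard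
    have hM : ∑ i, (#(M (x i)) : ℝ) ≤ j * t := by
      simpa using sum_le_card_nsmul univ (fun i => (#(M (x i)) : ℝ)) t fun i _ => by
        simpa [A] using (hG i).1
    have hjk : (j : ℝ) * t ≤ k * t := by gcongr
    linarith

/-- If in a finite pseudometric space the number of ordered pairs at distance in
`(r, 3r]` is at most `α·|X|²` and the number of ordered `(k+1)`-tuples with pairwise
distances exceeding `r` is at most `β·|X|^{k+1}`, then there is an `r`-cluster structure
of order `k` of total cardinality at least
`(1 − √α·(2k+1) − (k(e+1)+1)·β^{1/(k+1)})·|X|`. -/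
theorem finite_main_theorem
    {X : Type*} [Fintype X] [PseudoMetricSpace X] (r : ℝ) (hr : 0 < r)
    (k : ℕ) (hk : 2 ≤ k) (α β : ℝ) (hα : 0 < α) (hβ : 0 < β)
    (hmed : (Set.ncard {p : X × X | r < dist p.1 p.2 ∧ dist p.1 p.2 ≤ 3 * r} : ℝ) ≤
      α * (Fintype.card X : ℝ) ^ 2)
    (hanti : (Set.ncard {f : Fin (k + 1) → X |
        ∀ i j : Fin (k + 1), i < j → r < dist (f i) (f j)} : ℝ) ≤
      β * (Fintype.card X : ℝ) ^ (k + 1)) :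
    ∃ C : Fin k → Finset X, IsFinClusterStructure r k C ∧
      (1 - Real.sqrt α * (2 * (k : ℝ) + 1) -
          ((k : ℝ) * (Real.exp 1 + 1) + 1) * β ^ ((1 : ℝ) / ((k : ℝ) + 1))) *
          (Fintype.card X : ℝ) ≤
        ∑ i, ((C i).card : ℝ) := by
  rcases isEmpty_or_nonempty X with hX | hX
  · exact ⟨fun _ => ∅, ⟨fun i => by simpa using hr.le, by simp⟩, by simp⟩
  have hbpow : (β ^ ((1 : ℝ) / ((k : ℝ) + 1))) ^ (k + 1) = β := by
    rw [one_div]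
    exact_mod_cast Real.rpow_inv_natCast_pow hβ.le k.succ_ne_zero
  obtain ⟨C, hC, hcard⟩ := exists_isFinClusterStructure_card_ge r
    (√α * Fintype.card X) (β ^ ((1 : ℝ) / ((k : ℝ) + 1)) * Fintype.card X) hr
    (by positivity) (by positivity) k
    (by rwa [mul_pow, Real.sq_sqrt hα.le]) (by rwa [mul_pow, hbpow])
  refine ⟨C, hC, le_trans ?_ hcard⟩
  have h1 : 0 ≤ k * (√α * Fintype.card X) := by positivity
  have h2 : 0 ≤ k * Real.exp 1 * (β ^ ((1 : ℝ) / ((k : ℝ) + 1)) * Fintype.card X) := by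
    positivity
  linarith
end

section
/- Let (X, ρ) be a compact metric space with a finite Borel measure μ, r > 0, k ≥ 2 an integer, and α, β > 0. Suppose that the product measure μ⊗μ of the set {(x, y) ∈ X² : r < ρ(x, y) ≤ 3r} is at most α·μ(X)², and the product measure μ^{⊗(k+1)} of the set {(x₁, …, x_{k+1}) ∈ X^{k+1} : ρ(x_i, x_j) > r for all 1 ≤ i < j ≤ k+1} is at most β·μ(X)^{k+1}. Then there exists an r-cluster structure {X₁*, …, X_k*} of order k with Σ_{i=1}^k μ(X_i*) ≥ Ψ(α, β)·μ(X), where Ψ(α, β) = 1 − √α·(2k + 1) − (k(e + 1) + 1)·β^{1/(k+1)} and e is Euler's number. In particular, the r-cluster structure of order k of maximal measure 𝒳* satisfies μ(𝒳*) ≥ Ψ(α, β)·μ(X). -/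
open MeasureTheory

/-- The tuples of points of `R` at pairwise distance greater than `r`. -/
def separatedTuples {X : Type*} [MetricSpace X] (R : Set X) (r : ℝ) (n : ℕ) : Set (Fin n → X) :=
  {f | (∀ i, f i ∈ R) ∧ ∀ i j, i < j → r < dist (f i) (f j)}

section

variable {X : Type*} [MetricSpace X]

lemma cons_mem_separatedTuples {R : Set X} {r : ℝ} {n : ℕ} {y : X} {f : Fin n → X} :
    (Fin.cons y f : Fin (n + 1) → X) ∈ separatedTuples R r (n + 1) ↔
      f ∈ separatedTuples R r n ∧ y ∈ R ∧ ∀ i, r < dist y (f i) := by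
  constructor
  · rintro ⟨hR, hd⟩
    exact ⟨⟨fun i => by simpa using hR i.succ,
        fun i j hij => by simpa using hd i.succ j.succ (Fin.succ_lt_succ_iff.2 hij)⟩,
      by simpa using hR 0, fun i => by simpa using hd 0 i.succ (Fin.succ_pos i)⟩
  · rintro ⟨⟨hR, hd⟩, hy, hyd⟩
    refine ⟨fun i => ?_, fun i j hij => ?_⟩
    · cases i using Fin.cases with
      | zero => simpa using hy
      | succ i => simpa using hR i
    · cases j using Fin.cases with
      | zero => exact absurd hij (Fin.not_lt_zero i)
      | succ j =>
        cases i using Fin.cases with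
        | zero => simpa using hyd j
        | succ i => simpa using hd i j (Fin.succ_lt_succ_iff.1 hij)

variable [MeasurableSpace X] [BorelSpace X] [SecondCountableTopology X]

lemma measurableSet_separatedTuples {R : Set X} (hR : MeasurableSet R) (r : ℝ) (n : ℕ) :
    MeasurableSet (separatedTuples R r n) := by
  simp only [separatedTuples, Set.ofPred_and, Set.ofPred_forall]
  refine (MeasurableSet.iInter fun i => measurable_pi_apply i hR).inter
    (MeasurableSet.iInter fun i => MeasurableSet.iInter fun j => MeasurableSet.iInter fun _ => ?_)
  exact measurableSet_lt measurable_const ((measurable_pi_apply i).dist (measurable_pi_apply j))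

variable (μ : Measure X) [IsFiniteMeasure μ]

/-- If every closed ball of radius `r` centred in `R` has measure at most `s`, then greedily
choosing points shows that separated tuples in `R` are plentiful. -/
lemma pow_le_pi_separatedTuples {R : Set X} (hR : MeasurableSet R) {r : ℝ} {s : ENNReal}
    (hs : ∀ y ∈ R, μ (Metric.closedBall y r) ≤ s) {n : ℕ} (hn : n * s ≤ μ R) :
    s ^ n ≤ (Measure.pi fun _ : Fin n => μ) (separatedTuples R r n) := by
  induction n with
  | zero =>
    have h : separatedTuples R r 0 = Set.univ.pi fun _ => Set.univ := by
      ext f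
      simp [separatedTuples]
    rw [h, Measure.pi_pi]
    simp
  | succ n ih =>
    have hle : (n : ENNReal) * s ≤ μ R := le_trans (by gcongr; simp) hn
    by_cases hs_top : s = ⊤
    · rw [hs_top, Nat.cast_succ, ENNReal.mul_top (by simp)] at hn
      exact absurd (top_le_iff.1 hn) (measure_ne_top μ R)
    let e := MeasurableEquiv.piFinSuccAbove (fun _ : Fin (n + 1) => X) 0
    have he : MeasurePreserving e.symm (μ.prod (Measure.pi fun _ : Fin n => μ))
        (Measure.pi fun _ : Fin (n + 1) => μ) :=
      (measurePreserving_piFinSuccAbove (fun _ : Fin (n + 1) => μ) 0).symm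
    have hmeas := measurableSet_separatedTuples hR r (n + 1)
    rw [← he.measure_preimage hmeas.nullMeasurableSet,
      Measure.prod_apply_symm (e.symm.measurable hmeas)]
    have hslice : ∀ f ∈ separatedTuples R r n,
        s ≤ μ ((fun y => (y, f)) ⁻¹' (e.symm ⁻¹' separatedTuples R r (n + 1))) := by
      intro f hf
      have hsub : R ⊆ ((fun y => (y, f)) ⁻¹' (e.symm ⁻¹' separatedTuples R r (n + 1))) ∪
          ⋃ i, Metric.closedBall (f i) r := by
        intro y hy
        by_cases hyd : ∀ i, r < dist y (f i)
        · left
          rw [Set.mem_preimage, Set.mem_preimage]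
          have hcons : e.symm (y, f) = Fin.cons y f := Fin.insertNth_zero' y f
          rw [hcons]
          exact cons_mem_separatedTuples.2 ⟨hf, hy, hyd⟩
        · push Not at hyd
          exact Or.inr (Set.mem_iUnion.2 hyd)
      have hballs : μ (⋃ i, Metric.closedBall (f i) r) ≤ n * s := by
        refine (measure_iUnion_fintype_le μ _).trans
          ((Finset.sum_le_sum fun i _ => hs _ (hf.1 i)).trans ?_)
        simp
      have hsum := (hn.trans (measure_mono hsub)).trans
        ((measure_union_le _ _).trans (add_le_add_right hballs _))
      rw [Nat.cast_succ, add_mul, one_mul, add_comm] at hsum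
      exact (ENNReal.add_le_add_iff_right
        (ENNReal.mul_ne_top (ENNReal.natCast_ne_top n) hs_top)).1 hsum
    calc s ^ (n + 1) = s * s ^ n := pow_succ' s n
      _ ≤ s * (Measure.pi fun _ : Fin n => μ) (separatedTuples R r n) := by gcongr; exact ih hle
      _ = ∫⁻ _ in separatedTuples R r n, s ∂(Measure.pi fun _ : Fin n => μ) := by
        rw [setLIntegral_const]
      _ ≤ ∫⁻ f in separatedTuples R r n,
          μ ((fun y => (y, f)) ⁻¹' (e.symm ⁻¹' separatedTuples R r (n + 1)))
            ∂(Measure.pi fun _ : Fin n => μ) :=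
        setLIntegral_mono' (measurableSet_separatedTuples hR r n) hslice
      _ ≤ _ := setLIntegral_le_lintegral _ _

/-- A set in which all closed `r`-balls have measure at most `s` is small if the `n`-tuples of
points at pairwise distance greater than `r` have measure at most `s ^ n`. -/
lemma measureReal_le_of_small_balls {R : Set X} (hR : MeasurableSet R) {r s : ℝ} (hs₀ : 0 ≤ s)
    (hs : ∀ y ∈ R, μ.real (Metric.closedBall y r) ≤ s) {n : ℕ} (hn : n ≠ 0)
    (hsep : (Measure.pi fun _ : Fin n => μ).real
      {f | ∀ i j : Fin n, i < j → r < dist (f i) (f j)} ≤ s ^ n) :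
    μ.real R ≤ n * s := by
  by_contra! hlt
  have hn' : (0 : ℝ) < n := by positivity
  have hst : s < μ.real R / n := by rwa [lt_div_iff₀' hn']
  have key := pow_le_pi_separatedTuples (r := r) (s := ENNReal.ofReal (μ.real R / n)) (n := n) μ hR
    (fun y hy => by
      rw [← ofReal_measureReal]
      exact ENNReal.ofReal_le_ofReal ((hs y hy).trans hst.le))
    (by
      rw [← ENNReal.ofReal_natCast, ← ENNReal.ofReal_mul hn'.le, mul_div_cancel₀ _ hn'.ne',
        ofReal_measureReal])
  have hpow : (μ.real R / n) ^ n ≤ s ^ n := by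
    refine le_trans ?_ hsep
    rw [← ENNReal.ofReal_pow (hs₀.trans hst.le)] at key
    have := (ENNReal.ofReal_le_iff_le_toReal (measure_ne_top _ _)).1 key
    exact this.trans (measureReal_mono fun f hf => hf.2)
  exact absurd hpow (not_le.2 (pow_lt_pow_left₀ hst hs₀ hn))

end

/-- A set far from `k` heavy, well-separated balls is small if the `(k + 1)`-tuples of points at
pairwise distance greater than `r` have measure at most `s ^ (k + 1)`. -/
lemma measureReal_le_of_large_balls {X : Type*} [MetricSpace X] [MeasurableSpace X]
    (μ : Measure X) [IsFiniteMeasure μ] {R : Set X} {r s : ℝ} (hr : 0 ≤ r) (hs₀ : 0 < s)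
    {k : ℕ} {x : Fin k → X} (hx : ∀ i j, i < j → 3 * r < dist (x i) (x j))
    (hs : ∀ i, s ≤ μ.real (Metric.closedBall (x i) r))
    (hRx : ∀ y ∈ R, ∀ i, 3 * r < dist y (x i))
    (hsep : (Measure.pi fun _ : Fin (k + 1) => μ).real
      {f | ∀ i j : Fin (k + 1), i < j → r < dist (f i) (f j)} ≤ s ^ (k + 1)) :
    μ.real R ≤ s := by
  let A : Fin (k + 1) → Set X := Fin.cons R fun i => Metric.closedBall (x i) r
  have hsub : Set.univ.pi A ⊆ {f | ∀ i j : Fin (k + 1), i < j → r < dist (f i) (f j)} := by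
    intro f hf i j hij
    have hball : ∀ i : Fin k, dist (f i.succ) (x i) ≤ r := fun i => hf i.succ (Set.mem_univ _)
    cases j using Fin.cases with
    | zero => exact absurd hij (Fin.not_lt_zero i)
    | succ j =>
      cases i using Fin.cases with
      | zero =>
        have h0 : f 0 ∈ R := hf 0 (Set.mem_univ _)
        linarith [hRx _ h0 j, hball j, dist_triangle (f 0) (f j.succ) (x j)]
      | succ i =>
        linarith [hx i j (Fin.succ_lt_succ_iff.1 hij), hball i, hball j,
          dist_triangle4_left (f i.succ) (f j.succ) (x i) (x j)]
  have hprod : μ.real R * s ^ k ≤ s * s ^ k := by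
    calc μ.real R * s ^ k ≤ μ.real R * ∏ i, μ.real (Metric.closedBall (x i) r) := by
          gcongr
          calc s ^ k = ∏ _i : Fin k, s := by simp
            _ ≤ _ := Finset.prod_le_prod (fun _ _ => hs₀.le) fun i _ => hs i
      _ = (Measure.pi fun _ : Fin (k + 1) => μ).real (Set.univ.pi A) := by
          simp [measureReal_def, Measure.pi_pi, Fin.prod_univ_succ, A, ENNReal.toReal_prod]
      _ ≤ s * s ^ k := (measureReal_mono hsub).trans (hsep.trans_eq (pow_succ' s k))
  exact le_of_mul_le_mul_right hprod (by positivity)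

/-- Markov's inequality for the measures of the slices of a set in a product. -/
lemma measureReal_slice_ge_le {X : Type*} [MeasurableSpace X] (μ : Measure X)
    [IsFiniteMeasure μ] {S : Set (X × X)} (hS : MeasurableSet S) {c : ℝ} (hc : 0 < c)
    (h : (μ.prod μ).real S ≤ c * c) :
    μ.real {x | c ≤ μ.real (Prod.mk x ⁻¹' S)} ≤ c := by
  have hset : {x | c ≤ μ.real (Prod.mk x ⁻¹' S)} =
      {x | ENNReal.ofReal c ≤ μ (Prod.mk x ⁻¹' S)} := by
    ext x
    exact (ENNReal.ofReal_le_iff_le_toReal (measure_ne_top _ _)).symm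
  have hmk := mul_meas_ge_le_lintegral (μ := μ) (measurable_measure_prodMk_left (ν := μ) hS)
    (ENNReal.ofReal c)
  rw [← Measure.prod_apply hS, ← hset] at hmk
  have hreal := ENNReal.toReal_mono (measure_ne_top _ _) hmk
  rw [ENNReal.toReal_mul, ENNReal.toReal_ofReal hc.le] at hreal
  exact le_of_mul_le_mul_left (hreal.trans h) hc

/-- In a set `H`, either `k` points at pairwise distance greater than `d` exist, or some shorter
such family is maximal. -/
lemma exists_maximal_separated {X : Type*} [MetricSpace X] (H : Set X) (d : ℝ) (k : ℕ) :
    ∃ n ≤ k, ∃ x ∈ separatedTuples H d n, n = k ∨ ∀ y ∈ H, ∃ i, dist y (x i) ≤ d := by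
  classical
  let P : ℕ → Prop := fun n => (separatedTuples H d n).Nonempty
  have h0 : P 0 := ⟨Fin.elim0, fun i => i.elim0, fun i => i.elim0⟩
  obtain ⟨x, hx⟩ : P (Nat.findGreatest P k) := Nat.findGreatest_spec (Nat.zero_le k) h0
  refine ⟨Nat.findGreatest P k, Nat.findGreatest_le k, x, hx, ?_⟩
  by_contra! hcon
  obtain ⟨hne, y, hy, hyd⟩ := hcon
  exact Nat.findGreatest_is_greatest (Nat.lt_succ_self _)
    (Nat.lt_of_le_of_ne (Nat.findGreatest_le k) hne)
    ⟨_, cons_mem_separatedTuples.2 ⟨hx, hy, hyd⟩⟩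

lemma isClusterStructure_append_closedBall {X : Type*} [MetricSpace X] [MeasurableSpace X]
    [OpensMeasurableSpace X] {r : ℝ} (hr : 0 ≤ r) {n : ℕ} {x : Fin n → X}
    (hx : ∀ i j, i < j → 3 * r < dist (x i) (x j)) (d : ℕ) :
    IsClusterStructure r (n + d)
      (Fin.append (fun i => Metric.closedBall (x i) r) fun _ : Fin d => (∅ : Set X)) := by
  refine ⟨fun i => ?_, fun i => ?_, fun i j hij p hp q hq => ?_⟩
  · cases i using Fin.addCases with
    | left i => simpa using Metric.isClosed_closedBall.measurableSet
    | right i => simp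
  · cases i using Fin.addCases with
    | left i => simpa using Metric.diam_closedBall hr
    | right i => simpa using hr
  · cases i using Fin.addCases with
    | right i => simp at hp
    | left i =>
      cases j using Fin.addCases with
      | right j => simp at hq
      | left j =>
        have hp' : dist p (x i) ≤ r := by simpa using hp
        have hq' : dist q (x j) ≤ r := by simpa using hq
        linarith [hx i j hij, dist_triangle4_left p q (x i) (x j)]

/-- Main theorem, compact case.  If in a compact metric space with a finite Borel
measure `μ` the measure (w.r.t. `μ ⊗ μ`) of the set of pairs at distance in `(r, 3r]`
is at most `α·μ(X)²` and the measure (w.r.t. `μ^{⊗(k+1)}`) of the set of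
`(k+1)`-tuples with pairwise distances exceeding `r` is at most `β·μ(X)^{k+1}`, then
there is an `r`-cluster structure of order `k` of measure at least `Ψ(α, β)·μ(X)`,
where `Ψ(α, β) = 1 − √α·(2k+1) − (k(e+1)+1)·β^{1/(k+1)}`. -/
theorem compact_main_theorem
    {X : Type*} [MetricSpace X] [CompactSpace X]
    [MeasurableSpace X] [BorelSpace X]
    (μ : Measure X) [IsFiniteMeasure μ]
    (r : ℝ) (hr : 0 < r) (k : ℕ) (hk : 2 ≤ k) (α β : ℝ) (hα : 0 < α) (hβ : 0 < β)
    (hmed : ((μ.prod μ) {p : X × X | r < dist p.1 p.2 ∧ dist p.1 p.2 ≤ 3 * r}).toReal ≤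
      α * (μ Set.univ).toReal ^ 2)
    (hanti : ((Measure.pi fun _ : Fin (k + 1) => μ) {f : Fin (k + 1) → X |
        ∀ i j : Fin (k + 1), i < j → r < dist (f i) (f j)}).toReal ≤
      β * (μ Set.univ).toReal ^ (k + 1)) :
    ∃ C : Fin k → Set X, IsClusterStructure r k C ∧
      (1 - Real.sqrt α * (2 * (k : ℝ) + 1) -
          ((k : ℝ) * (Real.exp 1 + 1) + 1) * β ^ ((1 : ℝ) / ((k : ℝ) + 1))) *
          (μ Set.univ).toReal ≤
        ∑ i, (μ (C i)).toReal := by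
  rcases eq_or_lt_of_le (measureReal_nonneg (μ := μ) (s := Set.univ)) with hM | hM
  · refine ⟨fun _ => ∅, ⟨fun _ => MeasurableSet.empty, fun _ => ?_, fun _ _ _ _ h => h.elim⟩, ?_⟩
    · simpa using hr.le
    · rw [← measureReal_def, ← hM]
      simp
  set M := μ.real Set.univ with hM_def
  set b := β ^ ((1 : ℝ) / ((k : ℝ) + 1)) with hb_def
  set a := Real.sqrt α with ha_def
  have ha : 0 < a := Real.sqrt_pos.2 hα
  have hb : 0 < b := Real.rpow_pos_of_pos hβ _
  have haα : α = a * a := (Real.mul_self_sqrt hα.le).symm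
  have hbβ : β = b ^ (k + 1) := by
    rw [hb_def, ← Real.rpow_natCast, ← Real.rpow_mul hβ.le, Nat.cast_succ,
      one_div_mul_cancel (by positivity), Real.rpow_one]
  have hsep : (Measure.pi fun _ : Fin (k + 1) => μ).real
      {f | ∀ i j : Fin (k + 1), i < j → r < dist (f i) (f j)} ≤ (b * M) ^ (k + 1) := by
    rw [mul_pow, ← hbβ]
    exact hanti
  let S : Set (X × X) := {p | r < dist p.1 p.2 ∧ dist p.1 p.2 ≤ 3 * r}
  have hS : MeasurableSet S :=
    (measurableSet_lt measurable_const (measurable_fst.dist measurable_snd)).inter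
      (measurableSet_le (measurable_fst.dist measurable_snd) measurable_const)
  let B : Set X := {x | a * M ≤ μ.real (Prod.mk x ⁻¹' S)}
  have hB : MeasurableSet B :=
    measurableSet_le measurable_const (measurable_measure_prodMk_left hS).ennreal_toReal
  have hBle : μ.real B ≤ a * M := by
    refine measureReal_slice_ge_le μ hS (mul_pos ha hM) (hmed.trans_eq ?_)
    rw [← measureReal_def, haα]
    ring
  obtain ⟨n, hnk, x, ⟨hxH, hxd⟩, hmax⟩ := exists_maximal_separated
    {x | x ∈ Bᶜ ∧ b * M ≤ μ.real (Metric.closedBall x r)} (3 * r) k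
  let R : Set X := Bᶜ \ ⋃ i, Metric.closedBall (x i) (3 * r)
  have hR : MeasurableSet R :=
    hB.compl.diff (MeasurableSet.iUnion fun i => Metric.isClosed_closedBall.measurableSet)
  have hRx : ∀ y ∈ R, ∀ i, 3 * r < dist y (x i) := fun y hy i =>
    not_le.1 fun h => hy.2 (Set.mem_iUnion.2 ⟨i, h⟩)
  have hRle : μ.real R ≤ (k + 1) * (b * M) := by
    rcases hmax with rfl | hmax
    · have hbM : 0 < b * M := mul_pos hb hM
      have hRs := measureReal_le_of_large_balls μ hr.le hbM hxd (fun i => (hxH i).2) hRx hsep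
      nlinarith [(Nat.cast_nonneg n : (0 : ℝ) ≤ n)]
    · have hsmall : ∀ y ∈ R, μ.real (Metric.closedBall y r) ≤ b * M := by
        intro y hy
        by_contra! hlt
        obtain ⟨i, hi⟩ := hmax y ⟨hy.1, hlt.le⟩
        exact absurd hi (not_le.2 (hRx y hy i))
      exact_mod_cast measureReal_le_of_small_balls μ hR (by positivity) hsmall k.succ_ne_zero hsep
  have hcover : (Set.univ : Set X) ⊆
      (B ∪ R) ∪ ⋃ i, (Prod.mk (x i) ⁻¹' S ∪ Metric.closedBall (x i) r) := by
    intro y _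
    by_cases hyB : y ∈ B
    · exact Or.inl (Or.inl hyB)
    by_cases hyR : y ∈ R
    · exact Or.inl (Or.inr hyR)
    obtain ⟨i, hi⟩ : ∃ i, dist y (x i) ≤ 3 * r := by
      by_contra! h
      exact hyR ⟨hyB, fun hy => by
        obtain ⟨i, hi⟩ := Set.mem_iUnion.1 hy
        exact absurd hi (not_le.2 (h i))⟩
    refine Or.inr (Set.mem_iUnion.2 ⟨i, ?_⟩)
    rcases le_or_gt (dist y (x i)) r with h | h
    · exact Or.inr h
    · rw [dist_comm] at h hi
      exact Or.inl ⟨h, hi⟩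
  have hunion : μ.real (⋃ i, (Prod.mk (x i) ⁻¹' S ∪ Metric.closedBall (x i) r)) ≤
      n * (a * M) + ∑ i, μ.real (Metric.closedBall (x i) r) := by
    calc _ ≤ ∑ i, μ.real (Prod.mk (x i) ⁻¹' S ∪ Metric.closedBall (x i) r) :=
          measureReal_iUnion_fintype_le _
      _ ≤ ∑ i, (a * M + μ.real (Metric.closedBall (x i) r)) := by
          refine Finset.sum_le_sum fun i _ => (measureReal_union_le _ _).trans ?_
          gcongr
          exact (not_le.1 fun h => (hxH i).1 h).le
      _ = _ := by simp [Finset.sum_add_distrib]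
  have htotal : M ≤ a * M + (k + 1) * (b * M) + (k * (a * M) +
      ∑ i, μ.real (Metric.closedBall (x i) r)) := by
    calc M ≤ _ := measureReal_mono hcover
      _ ≤ (μ.real B + μ.real R) + _ :=
          (measureReal_union_le _ _).trans (add_le_add_left (measureReal_union_le _ _) _)
      _ ≤ _ := by
          have hnk' : (n : ℝ) * (a * M) ≤ k * (a * M) := by gcongr
          linarith
  obtain ⟨d, rfl⟩ := Nat.exists_eq_add_of_le hnk
  refine ⟨_, isClusterStructure_append_closedBall hr.le hxd d, ?_⟩
  simp only [← measureReal_def, Fin.sum_univ_add, Fin.append_left, Fin.append_right,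
    measureReal_empty, Finset.sum_const_zero, add_zero]
  rw [← hM_def]
  have h₁ : 0 ≤ ((n + d : ℕ) : ℝ) * (a * M) := by positivity
  have h₂ : 0 ≤ ((n + d : ℕ) : ℝ) * Real.exp 1 * (b * M) := by positivity
  linarith
end
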